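/- For the torus control system (lifted to ℝ^d × ℝ^d) with Hamiltonians H_u(q,p) = |p|²/2 + V_0(q) + Σ_{j=1}^d (u_{2j−1} cos(k_j·q) + u_{2j} sin(k_j·q)), let S(q,p) = (q, −p). Then for every r ∈ [1,∞), every torus density ρ and every ε > 0 there exist τ ∈ [0,ε] and a piecewise constant control u(·) on [0,τ] such that ‖ρ ∘ Φ^τ_{H_u} − ρ ∘ S‖_{L^r(Q)} < ε. -/

import Mathlib

open MeasureTheory Real

noncomputable section

/-- The phase space `T*ℝ^d = ℝ^d × ℝ^d` (positions `q` and momenta `p`),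
identified with `ℝ^{2d}` with the sup norm and the Lebesgue (symplectic volume) measure. -/
abbrev Phase (d : ℕ) := (Fin d → ℝ) × (Fin d → ℝ)

/-- The Hamiltonian vector field of a function `H : Phase d → ℝ`:
`H⃗(q,p) = (∂_p H(q,p), −∂_q H(q,p))`. -/
def hamVF {d : ℕ} (H : Phase d → ℝ) (x : Phase d) : Phase d :=
  (fun i => fderiv ℝ H x (0, Pi.single i 1),
   fun i => -(fderiv ℝ H x (Pi.single i 1, 0)))

/-- `φ` is the global flow of the (complete) vector field `X`. -/
def IsFlowOf {d : ℕ} (X : Phase d → Phase d) (φ : ℝ → Phase d → Phase d) : Prop :=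
  (∀ x, φ 0 x = x) ∧ ∀ x t, HasDerivAt (fun s => φ s x) (X (φ t x)) t

/-- `Φ` is a smooth diffeomorphism of phase space. -/
def IsDiffeo {d : ℕ} (Φ : Phase d → Phase d) : Prop :=
  ContDiff ℝ (⊤ : ℕ∞) Φ ∧
    ∃ Ψ, ContDiff ℝ (⊤ : ℕ∞) Ψ ∧ Function.LeftInverse Ψ Φ ∧ Function.RightInverse Ψ Φ

/-- `Φ` is a Hamiltonian diffeomorphism of `T*ℝ^d`: a smooth diffeomorphism which is the
time-1 flow map of a smooth time-dependent Hamiltonian whose non-autonomous Hamiltonian flow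
is defined on `[0,1]` from every initial point. -/
def IsHamDiffeo {d : ℕ} (Φ : Phase d → Phase d) : Prop :=
  IsDiffeo Φ ∧
  ∃ (H : ℝ → Phase d → ℝ) (φ : ℝ → Phase d → Phase d),
    ContDiff ℝ (⊤ : ℕ∞) (fun z : ℝ × Phase d => H z.1 z.2) ∧
    (∀ x, φ 0 x = x) ∧
    (∀ x, ∀ t ∈ Set.Icc (0:ℝ) 1,
      HasDerivWithinAt (fun s => φ s x) (hamVF (H t) (φ t x)) (Set.Icc (0:ℝ) 1) t) ∧
    Φ = φ 1

/-- `Φ` is the flow map from time `0` to time `τ` of the time-dependent Hamiltonian vector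
field `H⃗_{u(t)}` for some piecewise constant control `u(·) : [0,τ] → U` (finitely many
pieces): i.e. `Φ` is a finite composition of flows of the autonomous fields `H⃗_{u_i}`
for nonnegative durations summing to `τ`. -/
def Reachable {d : ℕ} {U : Type*} (Ham : U → Phase d → ℝ) (τ : ℝ)
    (Φ : Phase d → Phase d) : Prop :=
  ∃ (n : ℕ) (dur : Fin n → ℝ) (u : Fin n → U) (φ : Fin n → ℝ → Phase d → Phase d),
    (∀ i, 0 ≤ dur i) ∧ (∑ i, dur i) = τ ∧
    (∀ i, IsFlowOf (hamVF (Ham (u i))) (φ i)) ∧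
    Φ = (List.ofFn (fun i => φ i (dur i))).foldl (fun g f => f ∘ g) id

/-- `‖Φ − Ψ‖_{C^ℓ(K)} < ε`: all iterated derivatives of the difference up to order `ℓ`
are smaller than `ε` on `K`. -/
def CloseCl {d : ℕ} (ℓ : ℕ) (K : Set (Phase d)) (ε : ℝ) (Φ Ψ : Phase d → Phase d) : Prop :=
  ∀ j ≤ ℓ, ∀ x ∈ K, ‖iteratedFDeriv ℝ j (fun y => Φ y - Ψ y) x‖ < ε

/-- `Ψ ∈ R̄_st`: the diffeomorphism `Ψ` is small-time approximately reachable for the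
control system with controlled Hamiltonians `Ham u`, `u ∈ U`. -/
def SmallTimeReachable {d : ℕ} {U : Type*} (Ham : U → Phase d → ℝ)
    (Ψ : Phase d → Phase d) : Prop :=
  ∀ ε > 0, ∀ K : Set (Phase d), IsCompact K → ∀ ℓ : ℕ,
    ∃ τ ∈ Set.Icc (0:ℝ) ε, ∃ Φ, Reachable Ham τ Φ ∧ CloseCl ℓ K ε Φ Ψ

/-- A function `f` with complete Hamiltonian vector field is STAR (small-time approximately
reachable) if its flow at every time `s ∈ ℝ` belongs to `R̄_st`. -/
def IsSTAR {d : ℕ} {U : Type*} (Ham : U → Phase d → ℝ) (f : Phase d → ℝ) : Prop :=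
  (∃ φ, IsFlowOf (hamVF f) φ) ∧
  ∀ φ, IsFlowOf (hamVF f) φ → ∀ s : ℝ, SmallTimeReachable Ham (φ s)

/-- The Poisson bracket `{f,g} = Σ_j (∂_{p_j} f ∂_{q_j} g − ∂_{q_j} f ∂_{p_j} g)`. -/
def poissonBracket {d : ℕ} (f g : Phase d → ℝ) : Phase d → ℝ :=
  fun x => ∑ j, (fderiv ℝ f x (0, Pi.single j 1) * fderiv ℝ g x (Pi.single j 1, 0)
      - fderiv ℝ f x (Pi.single j 1, 0) * fderiv ℝ g x (0, Pi.single j 1))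

/-- The mechanical Hamiltonian `H_u(q,p) = |p|²/2 + V_0(q) + Σ_j u_j V_j(q)`. -/
def mechHam {d m : ℕ} (V0 : (Fin d → ℝ) → ℝ) (V : Fin m → (Fin d → ℝ) → ℝ)
    (u : Fin m → ℝ) : Phase d → ℝ :=
  fun x => (∑ i, (x.2 i) ^ 2) / 2 + V0 x.1 + ∑ j, u j * V j x.1

/-- The Euclidean controlled Hamiltonian
`H_u(q,p) = |p|²/2 + V_0(q) + Σ_{j=1}^d u_j q_j + u_{d+1} e^{−|q|²/2}`,
with control `u ∈ ℝ^d × ℝ ≃ ℝ^{d+1}`. -/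
def eucHam {d : ℕ} (V0 : (Fin d → ℝ) → ℝ) (u : (Fin d → ℝ) × ℝ) : Phase d → ℝ :=
  fun x => (∑ i, (x.2 i) ^ 2) / 2 + V0 x.1 + (∑ j, u.1 j * x.1 j)
    + u.2 * Real.exp (-(∑ i, (x.1 i) ^ 2) / 2)

/-- The frequencies `k_1 = e_1, …, k_{d−1} = e_{d−1}, k_d = (1,…,1)`. -/
def kvec (d : ℕ) (j : Fin d) : Fin d → ℝ :=
  if (j : ℕ) < d - 1 then Pi.single j 1 else fun _ => 1

/-- The torus controlled Hamiltonian (lifted to `ℝ^d × ℝ^d`)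
`H_u(q,p) = |p|²/2 + V_0(q) + Σ_{j=1}^d (u_{2j−1} cos(k_j·q) + u_{2j} sin(k_j·q))`,
with control `u ∈ (ℝ²)^d ≃ ℝ^{2d}`. -/
def torusHam {d : ℕ} (V0 : (Fin d → ℝ) → ℝ) (u : Fin d → ℝ × ℝ) : Phase d → ℝ :=
  fun x => (∑ i, (x.2 i) ^ 2) / 2 + V0 x.1 +
    ∑ j, ((u j).1 * Real.cos (∑ i, kvec d j i * x.1 i) +
          (u j).2 * Real.sin (∑ i, kvec d j i * x.1 i))

/-- The vertical shear `(q,p) ↦ (q, p − ∇f(q))`. -/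
def vshear {d : ℕ} (f : (Fin d → ℝ) → ℝ) : Phase d → Phase d :=
  fun x => (x.1, fun i => x.2 i - fderiv ℝ f x.1 (Pi.single i 1))

/-- The horizontal shear `(q,p) ↦ (q + ∇g(p), p)`. -/
def hshear {d : ℕ} (g : (Fin d → ℝ) → ℝ) : Phase d → Phase d :=
  fun x => (fun i => x.1 i + fderiv ℝ g x.2 (Pi.single i 1), x.2)

/-- `M` is a mesh of size `h`: the closed sup-norm cubes `C̄(m_n,h)` cover `ℝ^{2d}` and the
open cubes `C(m_n,h)` are pairwise disjoint. -/
def IsMesh {d : ℕ} (h : ℝ) (M : ℕ → Phase d) : Prop :=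
  (∀ x : Phase d, ∃ n, ‖x - M n‖ ≤ h) ∧
  ∀ n ℓ : ℕ, n ≠ ℓ →
    Disjoint {x : Phase d | ‖x - M n‖ < h} {x : Phase d | ‖x - M ℓ‖ < h}

/-- `F` is a permutation of the mesh `M` of size `h`: a bijection translating every open
cube of the mesh onto another one. -/
def IsMeshPermutation {d : ℕ} (h : ℝ) (M : ℕ → Phase d) (F : Phase d → Phase d) : Prop :=
  Function.Bijective F ∧
  ∀ n : ℕ, ∃ ℓ : ℕ, ∀ x : Phase d, ‖x - M n‖ < h → F x = x + (M ℓ - M n)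

/-- The fundamental domain `Q = [0,2π)^d × ℝ^d` of `T*𝕋^d` in `ℝ^d × ℝ^d`. -/
def torusBlock (d : ℕ) : Set (Phase d) :=
  {x : Phase d | ∀ i, 0 ≤ x.1 i ∧ x.1 i < 2 * Real.pi}

/-- A torus density of class `L^r`: a measurable function on `ℝ^d × ℝ^d`, `2π`-periodic in
each position variable, with finite `L^r` norm on the fundamental domain `Q`. -/
def IsTorusDensity {d : ℕ} (p : ENNReal) (ρ : Phase d → ℝ) : Prop :=
  Measurable ρ ∧
  (∀ (q : Fin d → ℝ) (pp : Fin d → ℝ) (k : Fin d → ℤ),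
    ρ (fun i => q i + 2 * Real.pi * (k i), pp) = ρ (q, pp)) ∧
  eLpNorm ρ p (volume.restrict (torusBlock d)) < ⊤

end
section helpers
open MeasureTheory Real Filter Topology
open scoped NNReal

/-- Uniform-time lemma for ODEs in a normed space. -/
theorem ode_global_of_uniform {E : Type*} [NormedAddCommGroup E] [NormedSpace ℝ E]
    (v : E → E) (hv : ContDiff ℝ 1 v) {ε : ℝ} (hε : 0 < ε)
    (h : ∀ x : E, ∃ γ : ℝ → E, γ 0 = x ∧ ∀ t ∈ Set.Ioo (-ε) ε, HasDerivAt γ (v (γ t)) t)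
    (x : E) : ∃ γ : ℝ → E, γ 0 = x ∧ ∀ t, HasDerivAt γ (v (γ t)) t := by
  obtain ⟨γ, h0, hγ⟩ := exists_isMIntegralCurve_of_isMIntegralCurveOn
    (I := modelWithCornersSelf ℝ E) (M := E) (v := v)
    (contMDiff_vectorSpace_iff_contDiff.2 hv) hε (fun x => by
      obtain ⟨γ, h0, hγ⟩ := h x
      exact ⟨γ, h0, fun t ht => ((hγ t ht).hasFDerivAt.hasMFDerivAt).hasMFDerivWithinAt⟩) x
  refine ⟨γ, h0, fun t => ?_⟩
  have h : HasFDerivAt γ ((1 : ℝ →L[ℝ] ℝ).smulRight (v (γ t))) t :=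
    hasMFDerivAt_iff_hasFDerivAt.1 (hγ t)
  exact h.hasDerivAt.congr_deriv (by simp)

/-- The mechanical vector field with force `F`. -/
def mechX {d : ℕ} (F : (Fin d → ℝ) → (Fin d → ℝ)) (x : Phase d) : Phase d := (x.2, F x.1)

theorem mechX_exists_flow {d : ℕ} {F : (Fin d → ℝ) → (Fin d → ℝ)} {K : ℝ≥0} {C : ℝ}
    (hF : ContDiff ℝ 1 F) (hL : LipschitzWith K F) (hC : ∀ q, ‖F q‖ ≤ C) :
    ∃ φ, IsFlowOf (mechX F) φ := by
  have hC0 : 0 ≤ C := (norm_nonneg _).trans (hC 0)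
  have key : ∀ x : Phase d, ∃ γ : ℝ → Phase d, γ 0 = x ∧
      ∀ t, HasDerivAt γ (mechX F (γ t)) t := by
    have hsm : ContDiff ℝ 1 (mechX F) := by
      unfold mechX; fun_prop
    apply ode_global_of_uniform _ hsm (ε := 1/2) (by norm_num)
    intro x
    obtain ⟨A, hA⟩ : ∃ A : ℝ≥0, (A : ℝ) = ‖x.2‖ + C := ⟨⟨‖x.2‖ + C, by positivity⟩, rfl⟩
    have hpl : IsPicardLindelof (fun _ => mechX F) (tmin := -(1/2)) (tmax := 1/2)
        ⟨0, by norm_num, by norm_num⟩ x A 0 (2 * A) (max 1 K) := by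
      apply IsPicardLindelof.of_time_independent
      · intro y hy
        have hy2 : ‖y.2 - x.2‖ ≤ ‖x.2‖ + C := by
          have := (norm_snd_le (y - x)).trans (by simpa [dist_eq_norm] using hy)
          rw [← hA]
          simpa using this
        have : ‖y.2‖ ≤ ‖x.2‖ + (‖x.2‖ + C) := by
          calc ‖y.2‖ = ‖x.2 + (y.2 - x.2)‖ := by congr 1; abel
            _ ≤ _ := (norm_add_le _ _).trans (by gcongr)
        have h3 := hC y.1
        have := norm_nonneg x.2
        simp only [mechX, Prod.norm_def, NNReal.coe_mul, hA]
        exact max_le (by push_cast; linarith) (by push_cast; linarith)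
      · apply LipschitzWith.lipschitzOnWith
        have a := (LipschitzWith.prod_snd (α := Fin d → ℝ) (β := Fin d → ℝ))
        have b := hL.comp (LipschitzWith.prod_fst (α := Fin d → ℝ) (β := Fin d → ℝ))
        have c := a.prodMk b
        rw [mul_one] at c
        exact c
      · simp; linarith
    obtain ⟨α, h0, hα⟩ := hpl.exists_eq_forall_mem_Icc_hasDerivWithinAt₀
    exact ⟨α, h0, fun t ht => (hα t ⟨ht.1.le, ht.2.le⟩).hasDerivAt (Icc_mem_nhds ht.1 ht.2)⟩
  choose γ h0 hγ using key
  exact ⟨fun t x => γ x t, h0, fun x t => hγ x t⟩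

theorem mvt_aux {E : Type*} [NormedAddCommGroup E] [NormedSpace ℝ E] {f f' : ℝ → E} {t B : ℝ}
    (ht : 0 ≤ t) (hf : ∀ s, HasDerivAt f (f' s) s)
    (hB : ∀ s, 0 ≤ s → s ≤ t → ‖f' s‖ ≤ B) : ‖f t - f 0‖ ≤ B * t := by
  have := norm_image_sub_le_of_norm_deriv_le_segment' (f := f) (f' := f') (a := 0) (b := t) (C := B)
    (fun x _ => (hf x).hasDerivWithinAt) (fun x hx => hB x hx.1 hx.2.le) t ⟨ht, le_rfl⟩
  simpa using this

section curve
variable {d : ℕ} {F : (Fin d → ℝ) → (Fin d → ℝ)} {K : ℝ≥0} {C : ℝ}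

theorem curve_fst {γ : ℝ → Phase d} (hγ : ∀ t, HasDerivAt γ (mechX F (γ t)) t) (t : ℝ) :
    HasDerivAt (fun s => (γ s).1) (γ t).2 t := (hγ t).fst

theorem curve_snd {γ : ℝ → Phase d} (hγ : ∀ t, HasDerivAt γ (mechX F (γ t)) t) (t : ℝ) :
    HasDerivAt (fun s => (γ s).2) (F (γ t).1) t := (hγ t).snd

theorem curve_est_a (hC : ∀ q, ‖F q‖ ≤ C) {γ : ℝ → Phase d}
    (hγ : ∀ t, HasDerivAt γ (mechX F (γ t)) t) {t : ℝ} (ht : 0 ≤ t) :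
    ‖(γ t).2 - (γ 0).2‖ ≤ C * t :=
  mvt_aux ht (curve_snd hγ) (fun _ _ _ => hC _)

theorem curve_est_b (hC : ∀ q, ‖F q‖ ≤ C) {γ : ℝ → Phase d}
    (hγ : ∀ t, HasDerivAt γ (mechX F (γ t)) t) {t : ℝ} (ht : 0 ≤ t) :
    ‖(γ t).1 - (γ 0).1 - t • (γ 0).2‖ ≤ C * t ^ 2 := by
  have hC0 : 0 ≤ C := (norm_nonneg _).trans (hC 0)
  have := mvt_aux (f := fun s => (γ s).1 - s • (γ 0).2) (f' := fun s => (γ s).2 - (γ 0).2)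
    (B := C * t) ht (fun s => by
      exact ((curve_fst hγ s).fun_sub ((hasDerivAt_id s).smul_const (γ 0).2)).congr_deriv (by simp))
    (fun s hs hst => (curve_est_a hC hγ hs).trans (by gcongr))
  calc _ = ‖((γ t).1 - t • (γ 0).2) - ((γ 0).1 - (0:ℝ) • (γ 0).2)‖ := by
        congr 1; simp; abel
    _ ≤ _ := this
    _ = _ := by ring

theorem curve_est_q (hC : ∀ q, ‖F q‖ ≤ C) {γ : ℝ → Phase d}
    (hγ : ∀ t, HasDerivAt γ (mechX F (γ t)) t) {t : ℝ} (ht : 0 ≤ t) :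
    ‖(γ t).1 - (γ 0).1‖ ≤ t * ‖(γ 0).2‖ + C * t ^ 2 := by
  calc _ = ‖t • (γ 0).2 + ((γ t).1 - (γ 0).1 - t • (γ 0).2)‖ := by congr 1; abel
    _ ≤ ‖t • (γ 0).2‖ + C * t ^ 2 := (norm_add_le _ _).trans (by gcongr; exact curve_est_b hC hγ ht)
    _ = _ := by rw [norm_smul, Real.norm_of_nonneg ht]

theorem curve_est_c (hL : LipschitzWith K F) (hC : ∀ q, ‖F q‖ ≤ C) {γ : ℝ → Phase d}
    (hγ : ∀ t, HasDerivAt γ (mechX F (γ t)) t) {t : ℝ} (ht : 0 ≤ t) :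
    ‖(γ t).2 - (γ 0).2 - t • F (γ 0).1‖ ≤ K * (t * ‖(γ 0).2‖ + C * t ^ 2) * t := by
  have hC0 : 0 ≤ C := (norm_nonneg _).trans (hC 0)
  have := mvt_aux (f := fun s => (γ s).2 - s • F (γ 0).1) (f' := fun s => F (γ s).1 - F (γ 0).1)
    (B := K * (t * ‖(γ 0).2‖ + C * t ^ 2)) ht (fun s => by
      exact ((curve_snd hγ s).fun_sub ((hasDerivAt_id s).smul_const (F (γ 0).1))).congr_deriv
        (by simp))
    (fun s hs hst => by
      have := hL.dist_le_mul (γ s).1 (γ 0).1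
      rw [dist_eq_norm, dist_eq_norm] at this
      refine this.trans ?_
      gcongr
      refine (curve_est_q hC hγ hs).trans ?_
      gcongr)
  calc _ = ‖((γ t).2 - t • F (γ 0).1) - ((γ 0).2 - (0:ℝ) • F (γ 0).1)‖ := by
        congr 1; simp; abel
    _ ≤ _ := this

/-- One step of the symplectic Euler method. -/
def eulerStep (F : (Fin d → ℝ) → (Fin d → ℝ)) (h : ℝ) (x : Phase d) : Phase d :=
  (x.1 + h • (x.2 + h • F x.1), x.2 + h • F x.1)

theorem eulerStep_lip (hL : LipschitzWith K F) {h : ℝ} (h0 : 0 ≤ h) (h1 : h ≤ 1) (x y : Phase d) :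
    ‖eulerStep F h x - eulerStep F h y‖ ≤ (1 + (1 + K) * h) * ‖x - y‖ := by
  have e1 : ‖x.1 - y.1‖ ≤ ‖x - y‖ := norm_fst_le (x - y)
  have e2 : ‖x.2 - y.2‖ ≤ ‖x - y‖ := norm_snd_le (x - y)
  have e3 : ‖F x.1 - F y.1‖ ≤ K * ‖x - y‖ := by
    have := hL.dist_le_mul x.1 y.1
    rw [dist_eq_norm, dist_eq_norm] at this
    exact this.trans (by gcongr)
  have hn := norm_nonneg (x - y)
  have hK := K.2
  have e4 : ‖(x.2 + h • F x.1) - (y.2 + h • F y.1)‖ ≤ (1 + h * K) * ‖x - y‖ := by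
    calc _ = ‖(x.2 - y.2) + h • (F x.1 - F y.1)‖ := by congr 1; rw [smul_sub]; abel
      _ ≤ ‖x.2 - y.2‖ + ‖h • (F x.1 - F y.1)‖ := norm_add_le _ _
      _ ≤ ‖x - y‖ + h * (K * ‖x - y‖) := by
        rw [norm_smul, Real.norm_of_nonneg h0]; gcongr
      _ = _ := by ring
  have e5 : ‖(x.1 + h • (x.2 + h • F x.1)) - (y.1 + h • (y.2 + h • F y.1))‖
      ≤ ‖x - y‖ + h * ((1 + h * K) * ‖x - y‖) := by
    calc _ = ‖(x.1 - y.1) + h • ((x.2 + h • F x.1) - (y.2 + h • F y.1))‖ := by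
          congr 1; rw [smul_sub]; abel
      _ ≤ ‖x.1 - y.1‖ + ‖h • ((x.2 + h • F x.1) - (y.2 + h • F y.1))‖ := norm_add_le _ _
      _ ≤ _ := by rw [norm_smul, Real.norm_of_nonneg h0]; gcongr
  rw [Prod.norm_def]
  refine max_le (e5.trans ?_) (e4.trans ?_)
  · have : h * (h * K) ≤ h * (1 * K) := by gcongr
    have : h * (h * K) * ‖x - y‖ ≤ h * (1 * K) * ‖x - y‖ := by gcongr
    nlinarith
  · nlinarith

theorem eulerStep_err (hL : LipschitzWith K F) (hC : ∀ q, ‖F q‖ ≤ C) {γ : ℝ → Phase d}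
    (hγ : ∀ t, HasDerivAt γ (mechX F (γ t)) t) {h : ℝ} (h0 : 0 ≤ h) (h1 : h ≤ 1) :
    ‖eulerStep F h (γ 0) - γ h‖ ≤ (2 * C + K * (‖(γ 0).2‖ + C)) * h ^ 2 := by
  have hC0 : 0 ≤ C := (norm_nonneg _).trans (hC 0)
  have hn := norm_nonneg (γ 0).2
  have hK : (0:ℝ) ≤ K := K.2
  rw [Prod.norm_def]
  refine max_le ?_ ?_
  · calc _ = ‖h • (h • F (γ 0).1) - ((γ h).1 - (γ 0).1 - h • (γ 0).2)‖ := by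
          simp only [eulerStep, Prod.fst_sub, smul_add]; congr 1; abel
      _ ≤ h * (h * C) + C * h ^ 2 := by
          refine (norm_sub_le _ _).trans ?_
          rw [norm_smul, norm_smul, Real.norm_of_nonneg h0]
          gcongr
          · exact hC _
          · exact curve_est_b hC hγ h0
      _ ≤ (2 * C + K * (‖(γ 0).2‖ + C)) * h ^ 2 := by
          have : 0 ≤ K * (‖(γ 0).2‖ + C) * h ^ 2 := by positivity
          nlinarith
  · calc _ = ‖(γ h).2 - (γ 0).2 - h • F (γ 0).1‖ := by
          rw [← norm_neg]; simp only [eulerStep, Prod.snd_sub]; congr 1; abel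
      _ ≤ K * (h * ‖(γ 0).2‖ + C * h ^ 2) * h := curve_est_c hL hC hγ h0
      _ ≤ K * (h * ‖(γ 0).2‖ + C * (1 * h)) * h := by
          rw [pow_two]; gcongr
      _ ≤ (2 * C + K * (‖(γ 0).2‖ + C)) * h ^ 2 := by
          have : 0 ≤ C * h ^ 2 := by positivity
          nlinarith

theorem eulerStep_iter_err (hL : LipschitzWith K F) (hC : ∀ q, ‖F q‖ ≤ C) {γ : ℝ → Phase d}
    (hγ : ∀ t, HasDerivAt γ (mechX F (γ t)) t) {h t : ℝ} (h0 : 0 ≤ h) (h1 : h ≤ 1) (k : ℕ)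
    (hk : k * h ≤ t) :
    ‖(eulerStep F h)^[k] (γ 0) - γ (k * h)‖ ≤
      Real.exp ((1 + K) * (k * h)) * (k * ((2 * C + K * (‖(γ 0).2‖ + C * t + C)) * h ^ 2)) := by
  have hC0 : 0 ≤ C := (norm_nonneg _).trans (hC 0)
  have hK : (0:ℝ) ≤ K := K.2
  induction k with
  | zero => simp
  | succ k ih =>
    push_cast at hk ⊢
    have hkh : 0 ≤ k * h := by positivity
    have ht : 0 ≤ t := by nlinarith
    have ih' := ih (by nlinarith)
    set B := (2 * C + K * (‖(γ 0).2‖ + C * t + C)) * h ^ 2 with hB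
    have hB0 : 0 ≤ B := by positivity
    have herr : ‖eulerStep F h (γ (k * h)) - γ ((k + 1) * h)‖ ≤ B := by
      have hγ' : ∀ s, HasDerivAt (fun s => γ (k * h + s)) (mechX F (γ (k * h + s))) s := by
        intro s
        exact (hγ (k * h + s)).comp_const_add (k * h) s
      have := eulerStep_err hL hC hγ' h0 h1
      simp only [add_zero] at this
      rw [show ((k:ℝ) + 1) * h = k * h + h by ring]
      refine this.trans ?_
      rw [hB]
      have h2 : ‖(γ (k * h)).2‖ ≤ ‖(γ 0).2‖ + C * t := by
        calc _ = ‖(γ 0).2 + ((γ (k * h)).2 - (γ 0).2)‖ := by congr 1; abel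
          _ ≤ ‖(γ 0).2‖ + C * (k * h) := (norm_add_le _ _).trans (by
              gcongr; exact curve_est_a hC hγ hkh)
          _ ≤ _ := by gcongr; nlinarith
      gcongr
    rw [Function.iterate_succ_apply']
    calc _ = ‖(eulerStep F h ((eulerStep F h)^[k] (γ 0)) - eulerStep F h (γ (k * h))) +
            (eulerStep F h (γ (k * h)) - γ ((k + 1) * h))‖ := by congr 1; abel
      _ ≤ (1 + (1 + K) * h) * (Real.exp ((1 + K) * (k * h)) * (k * B)) + B := by
          refine (norm_add_le _ _).trans ?_
          gcongr
          refine (eulerStep_lip hL h0 h1 _ _).trans ?_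
          gcongr
      _ ≤ Real.exp ((1 + K) * h) * (Real.exp ((1 + K) * (k * h)) * (k * B)) +
            Real.exp ((1 + K) * ((k + 1) * h)) * B := by
          gcongr
          · have := Real.add_one_le_exp ((1 + K) * h); linarith
          · refine le_mul_of_one_le_left hB0 (Real.one_le_exp ?_)
            positivity
      _ = _ := by
          rw [← mul_assoc, ← Real.exp_add]
          rw [show (1 + (K:ℝ)) * h + (1 + K) * (k * h) = (1 + K) * ((k + 1) * h) by ring]
          ring

theorem eulerStep_tendsto (hL : LipschitzWith K F) (hC : ∀ q, ‖F q‖ ≤ C) {γ : ℝ → Phase d}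
    (hγ : ∀ t, HasDerivAt γ (mechX F (γ t)) t) {t : ℝ} (ht : 0 ≤ t) :
    Tendsto (fun n : ℕ => (eulerStep F (t / (n + 1)))^[n + 1] (γ 0)) atTop (𝓝 (γ t)) := by
  rw [tendsto_iff_norm_sub_tendsto_zero]
  set B := Real.exp ((1 + K) * t) * (t * (2 * C + K * (‖(γ 0).2‖ + C * t + C)))
  have hlim' : Tendsto (fun n : ℕ => t / ((n:ℝ) + 1)) atTop (𝓝 0) := by
    have := (tendsto_const_div_atTop_nhds_zero_nat t).comp (tendsto_add_atTop_nat 1)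
    refine this.congr fun n => ?_
    simp
  have hlim : Tendsto (fun n : ℕ => B * (t / (n + 1))) atTop (𝓝 0) := by
    simpa using hlim'.const_mul B
  refine squeeze_zero' (Eventually.of_forall fun _ => norm_nonneg _) ?_ hlim
  filter_upwards [hlim'.eventually (eventually_le_nhds (b := 1) (by norm_num))] with n hn
  have hn1 : ((n:ℝ) + 1) ≠ 0 := by positivity
  have := eulerStep_iter_err hL hC hγ (h := t / (n + 1)) (t := t) (by positivity) hn (n + 1)
    (by push_cast; rw [mul_div_cancel₀ _ hn1])
  push_cast at this
  rw [mul_div_cancel₀ _ hn1] at this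
  refine this.trans (le_of_eq ?_)
  simp only [B]
  field_simp

end curve

/-- The lattice translation vector `(2πk, 0)`. -/
noncomputable def latt {d : ℕ} (k : Fin d → ℤ) : Phase d := (fun i => 2 * Real.pi * (k i), 0)

/-- Functions on phase space periodic under the lattice. -/
def PerFun {d : ℕ} {α : Type*} (g : Phase d → α) : Prop := ∀ k x, g (x + latt k) = g x

/-- Measurable, lattice-equivariant, measure non-expanding maps. -/
structure Good {d : ℕ} (F : Phase d → Phase d) : Prop where
  meas : Measurable F
  equi : ∀ k x, F (x + latt k) = F x + latt k
  contr : (volume : Measure (Phase d)).map F ≤ volume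

section good
variable {d : ℕ}

theorem Good.comp {F G : Phase d → Phase d} (hF : Good F) (hG : Good G) : Good (F ∘ G) where
  meas := hF.meas.comp hG.meas
  equi k x := by simp only [Function.comp, hG.equi, hF.equi]
  contr := by
    rw [← Measure.map_map hF.meas hG.meas]
    exact (Measure.map_mono hG.contr hF.meas).trans hF.contr

theorem good_id : Good (id : Phase d → Phase d) where
  meas := measurable_id
  equi k x := rfl
  contr := by simp

theorem Good.of_mp {F : Phase d → Phase d} (h : MeasurePreserving F)
    (he : ∀ k x, F (x + latt k) = F x + latt k) : Good F :=
  ⟨h.measurable, he, h.map_eq.le⟩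

theorem Good.iterate {F : Phase d → Phase d} (hF : Good F) (n : ℕ) : Good F^[n] := by
  induction n with
  | zero => exact good_id
  | succ n ih => rw [Function.iterate_succ']; exact hF.comp ih

theorem contr_of_tendsto_ae {F : ℕ → Phase d → Phase d} {G : Phase d → Phase d}
    (hF : ∀ n, Good (F n)) (hG : Measurable G)
    (h : ∀ᵐ x, Tendsto (fun n => F n x) atTop (𝓝 (G x))) :
    (volume : Measure (Phase d)).map G ≤ volume := by
  have hopen : ∀ U : Set (Phase d), IsOpen U → volume (G ⁻¹' U) ≤ volume U := by
    intro U hU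
    calc volume (G ⁻¹' U) = ∫⁻ x, U.indicator 1 (G x) := by
          rw [← lintegral_indicator_one (hG hU.measurableSet)]; rfl
      _ ≤ ∫⁻ x, liminf (fun n => U.indicator (1 : Phase d → ENNReal) (F n x)) atTop := by
          apply lintegral_mono_ae
          filter_upwards [h] with x h
          by_cases hx : G x ∈ U
          · rw [Set.indicator_of_mem hx]
            apply le_liminf_of_le (by isBoundedDefault)
            filter_upwards [h.eventually (hU.mem_nhds hx)] with n hn
            rw [Set.indicator_of_mem hn]
            simp
          · simp [Set.indicator_of_notMem hx]
      _ ≤ liminf (fun n => ∫⁻ x, U.indicator (1 : Phase d → ENNReal) (F n x)) atTop := by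
          apply lintegral_liminf_le
          intro n
          exact (measurable_one.indicator hU.measurableSet).comp (hF n).meas
      _ ≤ liminf (fun _ : ℕ => volume U) atTop := by
          apply liminf_le_liminf
          · refine Eventually.of_forall fun n => ?_
            have : ∫⁻ x, U.indicator (1 : Phase d → ENNReal) (F n x) = volume (F n ⁻¹' U) := by
              rw [← lintegral_indicator_one ((hF n).meas hU.measurableSet)]; rfl
            simp only [this]
            rw [← Measure.map_apply (hF n).meas hU.measurableSet]
            exact (hF n).contr U
          all_goals isBoundedDefault
      _ = volume U := by simp
  rw [Measure.le_iff]
  intro s hs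
  rw [Measure.map_apply hG hs, Set.measure_eq_iInf_isOpen s]
  refine le_iInf₂ fun U hsU => le_iInf fun hU => ?_
  exact (measure_mono (Set.preimage_mono hsU)).trans (hopen U hU)

theorem Good.of_tendsto {F : ℕ → Phase d → Phase d} {G : Phase d → Phase d}
    (hF : ∀ n, Good (F n)) (h : ∀ x, Tendsto (fun n => F n x) atTop (𝓝 (G x))) : Good G := by
  have hG : Measurable G := measurable_of_tendsto_metrizable (fun n => (hF n).meas)
    (tendsto_pi_nhds.2 h)
  refine ⟨hG, fun k x => ?_, ?_⟩
  · refine tendsto_nhds_unique (h (x + latt k)) ?_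
    simp_rw [(hF _).equi]
    exact (h x).add_const _
  · exact contr_of_tendsto_ae hF hG (Eventually.of_forall h)

/-- The vertical kick. -/
def kick (G : (Fin d → ℝ) → (Fin d → ℝ)) (x : Phase d) : Phase d := (x.1, x.2 + G x.1)

/-- The free drift. -/
def freeDrift (h : ℝ) (x : Phase d) : Phase d := (x.1 + h • x.2, x.2)

theorem kick_mp {G : (Fin d → ℝ) → (Fin d → ℝ)} (hG : Measurable G) :
    MeasurePreserving (kick G) := by
  have := (MeasurePreserving.id (volume : Measure (Fin d → ℝ))).skew_product
    (g := fun q p => p + G q) (μc := volume) (μd := volume)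
    (by unfold Function.uncurry; fun_prop)
    (Eventually.of_forall fun q => (measurePreserving_add_right volume (G q)).map_eq)
  exact this

theorem freeDrift_mp (h : ℝ) : MeasurePreserving (freeDrift (d := d) h) := by
  have := (MeasurePreserving.id (volume : Measure (Fin d → ℝ))).skew_product
    (g := fun p q => q + h • p) (μc := volume) (μd := volume)
    (by unfold Function.uncurry; fun_prop)
    (Eventually.of_forall fun q => (measurePreserving_add_right volume (h • q)).map_eq)
  have h2 := (Measure.measurePreserving_swap (μ := (volume : Measure (Fin d → ℝ)))
    (ν := (volume : Measure (Fin d → ℝ))))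
  exact h2.comp (this.comp h2)

/-- Periodicity of functions of position. -/
def PerQ {α : Type*} (G : (Fin d → ℝ) → α) : Prop := ∀ (k : Fin d → ℤ) q, G (q + (latt k).1) = G q

theorem kick_good {G : (Fin d → ℝ) → (Fin d → ℝ)} (hG : Measurable G) (hp : PerQ G) :
    Good (kick G) := by
  refine Good.of_mp (kick_mp hG) fun k x => ?_
  simp only [kick, Prod.fst_add, hp k, Prod.snd_add]
  ext i <;> simp [latt]

theorem freeDrift_good (h : ℝ) : Good (freeDrift (d := d) h) := by
  refine Good.of_mp (freeDrift_mp h) fun k x => ?_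
  ext i <;> simp [latt, freeDrift] <;> ring

theorem eulerStep_good {F : (Fin d → ℝ) → (Fin d → ℝ)} (hF : Continuous F) (hp : PerQ F) (h : ℝ) :
    Good (eulerStep F h) := by
  have : eulerStep F h = freeDrift h ∘ kick (fun q => h • F q) := rfl
  rw [this]
  refine (freeDrift_good h).comp (kick_good (by fun_prop) ?_)
  intro k q; simp only [hp k]

theorem flow_good {F : (Fin d → ℝ) → (Fin d → ℝ)} {K : ℝ≥0} {C : ℝ}
    (hL : LipschitzWith K F) (hC : ∀ q, ‖F q‖ ≤ C) (hp : PerQ F)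
    {φ : ℝ → Phase d → Phase d} (hφ : IsFlowOf (mechX F) φ) {t : ℝ} (ht : 0 ≤ t) :
    Good (φ t) := by
  refine Good.of_tendsto (F := fun n : ℕ => (eulerStep F (t / (n + 1)))^[n + 1])
    (fun n => (eulerStep_good hL.continuous hp _).iterate _) fun x => ?_
  have := eulerStep_tendsto hL hC (hφ.2 x) ht
  simpa only [hφ.1] using this

/-- The lattice as an additive subgroup. -/
noncomputable def lattGrp (d : ℕ) : AddSubgroup (Phase d) :=
  AddMonoidHom.range (AddMonoidHom.mk' (fun k : Fin d → ℤ => latt k) (by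
    intro a b; ext i <;> simp [latt, mul_add]))

instance (d : ℕ) : Countable (lattGrp d) := by
  unfold lattGrp
  exact (Set.countable_range _).to_subtype

instance (d : ℕ) : VAddInvariantMeasure (lattGrp d) (Phase d) volume where
  measure_preimage_vadd c s _ := by
    have h : (fun x : Phase d => c +ᵥ x) ⁻¹' s = (fun x => (c : Phase d) + x) ⁻¹' s := rfl
    rw [h]
    haveI : ((volume : Measure (Fin d → ℝ)).prod (volume : Measure (Fin d → ℝ))).IsAddLeftInvariant :=
      inferInstance
    exact measure_preimage_add ((volume : Measure (Fin d → ℝ)).prod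
      (volume : Measure (Fin d → ℝ))) (c : Phase d) s

theorem torusBlock_meas : MeasurableSet (torusBlock d) := by
  have : torusBlock d = ⋂ i, {x : Phase d | 0 ≤ x.1 i ∧ x.1 i < 2 * Real.pi} := by
    ext x; simp [torusBlock]
  rw [this]
  refine MeasurableSet.iInter fun i => ?_
  have : Measurable fun x : Phase d => x.1 i := by fun_prop
  exact (measurableSet_le measurable_const this).inter (measurableSet_lt this measurable_const)

theorem torusBlock_unique (x : Phase d) (k : Fin d → ℤ) :
    x + latt k ∈ torusBlock d ↔ k = fun i => - ⌊x.1 i / (2 * Real.pi)⌋ := by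
  have hpi := Real.two_pi_pos
  rw [funext_iff]
  refine forall_congr' fun i => ?_
  simp only [latt, Prod.fst_add, Pi.add_apply]
  rw [← neg_eq_iff_eq_neg, eq_comm, Int.floor_eq_iff]
  rw [le_div_iff₀ hpi, div_lt_iff₀ hpi]
  push_cast
  constructor
  · rintro ⟨a, b⟩; constructor <;> nlinarith
  · rintro ⟨a, b⟩; constructor <;> nlinarith

theorem torusBlock_fund : IsAddFundamentalDomain (lattGrp d) (torusBlock d) volume := by
  refine IsAddFundamentalDomain.mk' torusBlock_meas.nullMeasurableSet fun x => ?_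
  refine ⟨⟨latt fun i => - ⌊x.1 i / (2 * Real.pi)⌋, ⟨_, rfl⟩⟩, ?_, ?_⟩
  · change latt _ + x ∈ _
    rw [add_comm, torusBlock_unique]
  · rintro ⟨_, k, rfl⟩ hk
    change latt k + x ∈ _ at hk
    rw [add_comm, torusBlock_unique] at hk
    subst hk
    rfl

theorem Good.qmp {F : Phase d → Phase d} (hF : Good F) :
    Measure.QuasiMeasurePreserving F volume volume :=
  ⟨hF.meas, Measure.absolutelyContinuous_of_le hF.contr⟩

theorem Good.lintegral_eq {F : Phase d → Phase d} (hF : Good F) {h : Phase d → ENNReal}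
    (hm : Measurable h) (hp : PerFun h) :
    ∫⁻ x in torusBlock d, h (F x) = ∫⁻ x in torusBlock d, h x ∂(volume.map F) := by
  have hfd : IsAddFundamentalDomain (lattGrp d) (F ⁻¹' torusBlock d) volume := by
    refine torusBlock_fund.preimage_of_equiv hF.qmp (e := id) Function.bijective_id ?_
    rintro ⟨_, k, rfl⟩ x
    change F (latt k + x) = latt k + F x
    rw [add_comm, hF.equi, add_comm]
  rw [torusBlock_fund.setLIntegral_eq hfd, setLIntegral_map torusBlock_meas hm hF.meas]
  rintro ⟨_, k, rfl⟩ x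
  change h (F (latt k + x)) = _
  rw [add_comm, hF.equi, hp]

theorem Good.lintegral_le {F : Phase d → Phase d} (hF : Good F) {h : Phase d → ENNReal}
    (hm : Measurable h) (hp : PerFun h) :
    ∫⁻ x in torusBlock d, h (F x) ≤ ∫⁻ x in torusBlock d, h x := by
  rw [hF.lintegral_eq hm hp]
  exact lintegral_mono' (Measure.restrict_mono le_rfl hF.contr) le_rfl

theorem Good.eLpNorm_le {F : Phase d → Phase d} (hF : Good F) {r : ℝ} (hr : 1 ≤ r)
    {g : Phase d → ℝ} (hm : Measurable g) (hp : PerFun g) :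
    eLpNorm (fun x => g (F x)) (ENNReal.ofReal r) (volume.restrict (torusBlock d)) ≤
      eLpNorm g (ENNReal.ofReal r) (volume.restrict (torusBlock d)) := by
  have h0 : ENNReal.ofReal r ≠ 0 := by simp; linarith
  rw [eLpNorm_eq_lintegral_rpow_enorm_toReal h0 ENNReal.ofReal_ne_top,
    eLpNorm_eq_lintegral_rpow_enorm_toReal h0 ENNReal.ofReal_ne_top]
  refine ENNReal.rpow_le_rpow ?_ (by positivity)
  exact hF.lintegral_le (h := fun x => ‖g x‖ₑ ^ (ENNReal.ofReal r).toReal) (by fun_prop)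
    (fun k x => by simp only [hp k x])

end good

section limits

theorem scheffe_rpow {α : Type*} [MeasurableSpace α] {μ : Measure α} {f : ℕ → α → ℝ} {g : α → ℝ}
    (hf : ∀ n, Measurable (f n)) (hg : Measurable g) {r : ℝ} (hr : 1 ≤ r)
    (hle : ∀ n, ∫⁻ x, ‖f n x‖ₑ ^ r ∂μ ≤ ∫⁻ x, ‖g x‖ₑ ^ r ∂μ)
    (hfin : ∫⁻ x, ‖g x‖ₑ ^ r ∂μ ≠ ⊤)
    (hae : ∀ᵐ x ∂μ, Tendsto (fun n => f n x) atTop (𝓝 (g x))) :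
    Tendsto (fun n => ∫⁻ x, ‖f n x - g x‖ₑ ^ r ∂μ) atTop (𝓝 0) := by
  have hr0 : 0 < r := by linarith
  set C : ENNReal := 2 ^ (r - 1) with hC
  have hCt : C ≠ ⊤ := by
    rw [hC]; exact ENNReal.rpow_ne_top_of_nonneg (by linarith) (by simp)
  set I := ∫⁻ x, ‖g x‖ₑ ^ r ∂μ with hI
  set c : ℕ → α → ENNReal := fun n x => C * (‖f n x‖ₑ ^ r + ‖g x‖ₑ ^ r) with hc
  set b : ℕ → α → ENNReal := fun n x => ‖f n x - g x‖ₑ ^ r with hb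
  have hcm : ∀ n, Measurable (c n) := fun n => by
    have := hf n; fun_prop
  have hbm : ∀ n, Measurable (b n) := fun n => by
    have := hf n; fun_prop
  have hbc : ∀ n x, b n x ≤ c n x := fun n x => by
    calc b n x ≤ (‖f n x‖ₑ + ‖g x‖ₑ) ^ r := ENNReal.rpow_le_rpow (enorm_sub_le) hr0.le
      _ ≤ c n x := ENNReal.rpow_add_le_mul_rpow_add_rpow _ _ hr
  have hci : ∀ n, ∫⁻ x, c n x ∂μ ≤ C * (I + I) := fun n => by
    simp only [hc]
    rw [lintegral_const_mul _ (by have := hf n; fun_prop), lintegral_add_left (by have := hf n; fun_prop)]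
    gcongr
    exact hle n
  have hJt : C * (I + I) ≠ ⊤ := ENNReal.mul_ne_top hCt (by simp [hfin])
  set J := C * (I + I) with hJ
  have hbi : ∀ n, ∫⁻ x, b n x ∂μ ≤ J := fun n => (lintegral_mono (hbc n)).trans (hci n)
  have hlim : ∀ᵐ x ∂μ, liminf (fun n => c n x - b n x) atTop = C * (‖g x‖ₑ ^ r + ‖g x‖ₑ ^ r) := by
    filter_upwards [hae] with x hx
    have h1 : Tendsto (fun n => c n x) atTop (𝓝 (C * (‖g x‖ₑ ^ r + ‖g x‖ₑ ^ r))) := by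
      refine ENNReal.Tendsto.const_mul ?_ (Or.inr hCt)
      exact (((ENNReal.continuous_rpow_const (y := r)).tendsto _).comp hx.enorm).add tendsto_const_nhds
    have h2 : Tendsto (fun n => b n x) atTop (𝓝 0) := by
      have := ((ENNReal.continuous_rpow_const (y := r)).tendsto _).comp (hx.sub_const (g x)).enorm
      simpa [hr0, Function.comp_def] using this
    have h3 := ENNReal.Tendsto.sub h1 h2 (Or.inr (by simp))
    rw [tsub_zero] at h3
    exact h3.liminf_eq
  have hfatou : J ≤ liminf (fun n => J - ∫⁻ x, b n x ∂μ) atTop := by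
    calc J = ∫⁻ x, liminf (fun n => c n x - b n x) atTop ∂μ := by
          rw [lintegral_congr_ae hlim, lintegral_const_mul _ (by fun_prop),
            lintegral_add_left (by fun_prop)]
      _ ≤ liminf (fun n => ∫⁻ x, c n x - b n x ∂μ) atTop :=
          lintegral_liminf_le fun n => (hcm n).sub (hbm n)
      _ ≤ _ := by
          apply liminf_le_liminf
          · refine Eventually.of_forall fun n => ?_
            rw [lintegral_sub (hbm n) ((hbi n).trans_lt hJt.lt_top).ne
              (Eventually.of_forall (hbc n))]
            exact tsub_le_tsub_right (hci n) _
          all_goals isBoundedDefault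
  rw [ENNReal.tendsto_nhds_zero]
  intro ε hε
  by_cases hJ0 : J = 0
  · exact Eventually.of_forall fun n => ((hbi n).trans (by rw [hJ0])).trans hε.le
  have h5 : J - ε < liminf (fun n => J - ∫⁻ x, b n x ∂μ) atTop :=
    (ENNReal.sub_lt_self hJt hJ0 hε.ne').trans_le hfatou
  filter_upwards [eventually_lt_of_lt_liminf h5] with n hn
  by_contra hcon
  exact absurd hn (not_lt.2 (tsub_le_tsub_left (not_le.1 hcon).le _))

variable {d : ℕ}

theorem ae_coord {S : Set ℝ} (hS : S.Countable) : ∀ᵐ x : Phase d, ∀ i, x.1 i ∉ S := by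
  rw [ae_all_iff]
  intro i
  have h1 : ∀ᵐ q : Fin d → ℝ, q i ∉ S :=
    (Measure.quasiMeasurePreserving_eval (μ := fun _ : Fin d => (volume : Measure ℝ)) i).ae
      (hS.ae_notMem volume)
  exact (Measure.quasiMeasurePreserving_fst (μ := (volume : Measure (Fin d → ℝ)))
    (ν := (volume : Measure (Fin d → ℝ)))).ae h1

/-- Reduction of the position modulo the lattice. -/
noncomputable def fredu (x : Phase d) : Phase d := x + latt fun i => - ⌊x.1 i / (2 * Real.pi)⌋

theorem fredu_meas : Measurable (fredu (d := d)) := by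
  unfold fredu latt
  refine measurable_id.add (Measurable.prodMk (measurable_pi_lambda _ fun i => ?_) measurable_const)
  have : Measurable fun x : Phase d => (⌊x.1 i / (2 * Real.pi)⌋ : ℤ) :=
    Int.measurable_floor.comp (by fun_prop)
  have h2 : Measurable fun x : Phase d => ((-⌊x.1 i / (2 * Real.pi)⌋ : ℤ) : ℝ) :=
    measurable_from_top.comp this.neg
  exact h2.const_mul _

theorem latt_add (k l : Fin d → ℤ) : latt (k + l) = latt k + latt l := by
  ext i <;> simp [latt, mul_add]

theorem fredu_per : PerFun (fredu (d := d)) := by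
  intro k x
  have hpi := Real.two_pi_pos
  unfold fredu
  rw [add_assoc, ← latt_add]
  congr 2
  ext i
  have : (x + latt k).1 i / (2 * π) = x.1 i / (2 * π) + (k i : ℤ) := by
    simp only [latt, Prod.fst_add, Pi.add_apply]; field_simp
  simp only [Pi.add_apply, this, Int.floor_add_intCast]
  ring

theorem fredu_eq {x : Phase d} (hx : x ∈ torusBlock d) : fredu x = x := by
  have h := (torusBlock_unique x 0).1 (by
    have : latt (0 : Fin d → ℤ) = 0 := by ext i <;> simp [latt]
    rwa [this, add_zero])
  unfold fredu
  rw [← h]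
  ext i <;> simp [latt]

theorem fredu_cont {x : Phase d} (hx : ∀ i, x.1 i ∉ Set.range fun m : ℤ => 2 * π * m) :
    ContinuousAt fredu x := by
  have hpi := Real.two_pi_pos
  have h : ∀ᶠ y in 𝓝 x, ∀ i, ⌊y.1 i / (2 * π)⌋ = ⌊x.1 i / (2 * π)⌋ := by
    rw [eventually_all]
    intro i
    have hc : ContinuousAt (fun y : Phase d => y.1 i / (2 * π)) x := by fun_prop
    have hlt : (⌊x.1 i / (2 * π)⌋ : ℝ) < x.1 i / (2 * π) := by
      refine lt_of_le_of_ne (Int.floor_le _) fun he => hx i ⟨⌊x.1 i / (2 * π)⌋, ?_⟩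
      simp only
      rw [he]; field_simp
    filter_upwards [hc.eventually (lt_mem_nhds hlt),
      hc.eventually (gt_mem_nhds (Int.lt_floor_add_one (x.1 i / (2 * π))))] with y h1 h2
    exact Int.floor_eq_iff.2 ⟨h1.le, h2⟩
  have h2 : (fun y => y + latt fun i => - ⌊x.1 i / (2 * Real.pi)⌋) =ᶠ[𝓝 x] fredu := by
    filter_upwards [h] with y hy
    simp only [fredu, hy]
  exact ContinuousAt.congr (by fun_prop) h2

theorem density_per {p : ENNReal} {ρ : Phase d → ℝ} (h : IsTorusDensity p ρ) : PerFun ρ := by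
  intro k x
  have := h.2.1 x.1 x.2 k
  rw [← this]
  congr 1
  ext i <;> simp [latt]

theorem density_comp {r : ℝ} (hr : 1 ≤ r) {ρ : Phase d → ℝ}
    (h : IsTorusDensity (ENNReal.ofReal r) ρ) {F : Phase d → Phase d} (hF : Good F) :
    IsTorusDensity (ENNReal.ofReal r) (fun x => ρ (F x)) := by
  refine ⟨h.1.comp hF.meas, fun q p k => ?_, ?_⟩
  · have h1 := hF.equi k (q, p)
    have h2 : ((q, p) : Phase d) + latt k = (fun i => q i + 2 * Real.pi * (k i), p) := by
      ext i <;> simp [latt]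
    rw [h2] at h1
    beta_reduce
    rw [h1, density_per h]
  · exact (hF.eLpNorm_le hr h.1 (density_per h)).trans_lt h.2.2

theorem limit_lemma {F : ℕ → Phase d → Phase d} {G : Phase d → Phase d}
    (hF : ∀ n, Good (F n)) (hG : Good G) (hmp : MeasurePreserving G)
    (hlim : ∀ᵐ x, Tendsto (fun n => F n x) atTop (𝓝 (G x))) {r : ℝ} (hr : 1 ≤ r)
    {ρ : Phase d → ℝ} (hρ : IsTorusDensity (ENNReal.ofReal r) ρ) :
    Tendsto (fun n => eLpNorm (fun x => ρ (F n x) - ρ (G x)) (ENNReal.ofReal r)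
      (volume.restrict (torusBlock d))) atTop (𝓝 0) := by
  set p := ENNReal.ofReal r with hp
  set μ := (volume : Measure (Phase d)).restrict (torusBlock d) with hμ
  have h0 : p ≠ 0 := by simp [hp]; linarith
  have hpt : p ≠ ⊤ := ENNReal.ofReal_ne_top
  have hp1 : 1 ≤ p := by simpa [hp] using hr
  have hpr : p.toReal = r := ENNReal.toReal_ofReal (by linarith)
  rw [ENNReal.tendsto_nhds_zero]
  intro ε hε
  by_cases hεt : ε = ⊤
  · simp [hεt]
  have hmem : MemLp ((torusBlock d).indicator ρ) p volume :=
    (memLp_indicator_iff_restrict torusBlock_meas).2 ⟨hρ.1.aestronglyMeasurable, hρ.2.2⟩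
  have hε3 : ε / 3 ≠ 0 := (ENNReal.div_pos hε.ne' (by simp)).ne'
  have hreg : (volume : Measure (Phase d)).Regular :=
    Measure.Regular.of_sigmaCompactSpace_of_isLocallyFiniteMeasure
      ((volume : Measure (Fin d → ℝ)).prod (volume : Measure (Fin d → ℝ)))
  obtain ⟨g0, hcs, hgle, hgc, hgL⟩ := hmem.exists_hasCompactSupport_eLpNorm_sub_le hpt hε3
  set g : Phase d → ℝ := fun x => g0 (fredu x) with hg
  have hgm : Measurable g := hgc.measurable.comp fredu_meas
  have hgp : PerFun g := fun k x => by simp only [hg, fredu_per k x]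
  have hgQ : ∀ᵐ x ∂μ, g x = g0 x := by
    filter_upwards [ae_restrict_mem torusBlock_meas] with x hx
    simp only [hg, fredu_eq hx]
  have hdiff : eLpNorm (fun x => ρ x - g x) p μ ≤ ε / 3 := by
    refine le_trans ?_ hgle
    refine le_trans (le_of_eq ?_) (eLpNorm_mono_measure _ (Measure.restrict_le_self (s := torusBlock d)))
    apply eLpNorm_congr_ae
    filter_upwards [hgQ, ae_restrict_mem torusBlock_meas] with x hx hxQ
    simp [hx, Set.indicator_of_mem hxQ]
  have hdp : PerFun (fun x => ρ x - g x) := fun k x => by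
    simp only [density_per hρ k x, hgp k x]
  have hdm : Measurable (fun x => ρ x - g x) := hρ.1.sub hgm
  have hgfin : ∫⁻ x, ‖g x‖ₑ ^ r ∂μ ≠ ⊤ := by
    have h1 : MemLp g p μ := (memLp_congr_ae hgQ).2 (hgL.restrict _)
    have h2 := lintegral_rpow_enorm_lt_top_of_eLpNorm_lt_top h0 hpt h1.2
    rw [hpr] at h2
    exact h2.ne
  have hper : PerFun (fun x => ‖g x‖ₑ ^ r) := fun k x => by simp only [hgp k x]
  have hgG : ∫⁻ x, ‖g (G x)‖ₑ ^ r ∂μ = ∫⁻ x, ‖g x‖ₑ ^ r ∂μ := by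
    have := hG.lintegral_eq (h := fun x => ‖g x‖ₑ ^ r) (by fun_prop) hper
    rw [hmp.map_eq] at this
    exact this
  have hgF : ∀ n, ∫⁻ x, ‖g (F n x)‖ₑ ^ r ∂μ ≤ ∫⁻ x, ‖g (G x)‖ₑ ^ r ∂μ := fun n => by
    rw [hgG]
    exact (hF n).lintegral_le (h := fun x => ‖g x‖ₑ ^ r) (by fun_prop) hper
  have hcont : ∀ᵐ x ∂μ, Tendsto (fun n => g (F n x)) atTop (𝓝 (g (G x))) := by
    apply ae_restrict_of_ae
    have h1 : ∀ᵐ x : Phase d, ∀ i, (G x).1 i ∉ Set.range fun m : ℤ => 2 * π * m :=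
      hG.qmp.ae (ae_coord (Set.countable_range _))
    filter_upwards [hlim, h1] with x hx h2
    exact ((hgc.continuousAt).comp (fredu_cont h2)).tendsto.comp hx
  have hsch := scheffe_rpow (μ := μ) (f := fun n x => g (F n x)) (g := fun x => g (G x))
    (fun n => hgm.comp (hF n).meas) (hgm.comp hG.meas) hr hgF (by rw [hgG]; exact hgfin) hcont
  have hD : Tendsto (fun n => eLpNorm (fun x => g (F n x) - g (G x)) p μ) atTop (𝓝 0) := by
    simp_rw [eLpNorm_eq_lintegral_rpow_enorm_toReal h0 hpt, hpr]
    have := ((ENNReal.continuous_rpow_const (y := 1 / r)).tendsto _).comp hsch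
    have hr' : 0 < 1 / r := by positivity
    rw [ENNReal.zero_rpow_of_pos hr'] at this
    exact this
  filter_upwards [(ENNReal.tendsto_nhds_zero.1 hD) (ε / 3) (pos_iff_ne_zero.2 hε3)] with n hn
  have e1 : eLpNorm (fun x => ρ (F n x) - g (F n x)) p μ ≤ ε / 3 :=
    ((hF n).eLpNorm_le hr hdm hdp).trans hdiff
  have e2 : eLpNorm (fun x => ρ (G x) - g (G x)) p μ ≤ ε / 3 :=
    (hG.eLpNorm_le hr hdm hdp).trans hdiff
  have m1 : AEStronglyMeasurable (fun x => ρ (F n x) - g (F n x)) μ :=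
    (hdm.comp (hF n).meas).aestronglyMeasurable
  have m2 : AEStronglyMeasurable (fun x => ρ (G x) - g (G x)) μ :=
    (hdm.comp hG.meas).aestronglyMeasurable
  have m3 : AEStronglyMeasurable (fun x => g (F n x) - g (G x)) μ :=
    ((hgm.comp (hF n).meas).sub (hgm.comp hG.meas)).aestronglyMeasurable
  have heq : (fun x => ρ (F n x) - ρ (G x)) =
      ((fun x => ρ (F n x) - g (F n x)) + fun x => g (F n x) - g (G x)) -
        fun x => ρ (G x) - g (G x) := by
    ext x; simp
  rw [heq]
  calc _ ≤ eLpNorm ((fun x => ρ (F n x) - g (F n x)) + fun x => g (F n x) - g (G x)) p μ +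
        eLpNorm (fun x => ρ (G x) - g (G x)) p μ := eLpNorm_sub_le (m1.add m3) m2 hp1
    _ ≤ (ε / 3 + ε / 3) + ε / 3 := by
        gcongr
        exact (eLpNorm_add_le m1 m3 hp1).trans (add_le_add e1 hn)
    _ = ε := ENNReal.add_thirds ε

end limits

section force
variable {d : ℕ}

theorem per_bounded {E : Type*} [NormedAddCommGroup E] {G : (Fin d → ℝ) → E}
    (hG : Continuous G) (hp : PerQ G) : ∃ C, ∀ q, ‖G q‖ ≤ C := by
  have hK : IsCompact (Set.Icc (0 : Fin d → ℝ) (fun _ => 2 * π)) := isCompact_Icc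
  obtain ⟨C, hC⟩ := hK.exists_bound_of_continuousOn hG.continuousOn
  refine ⟨C, fun q => ?_⟩
  have h := (torusBlock_unique ((q, 0) : Phase d) _).2 rfl
  rw [← hp (fun i => - ⌊q i / (2 * Real.pi)⌋) q]
  exact hC _ ⟨fun i => (h i).1, fun i => (h i).2.le⟩

theorem per_fderiv {G : (Fin d → ℝ) → (Fin d → ℝ)} (hp : PerQ G) : PerQ (fderiv ℝ G) := by
  intro k q
  rw [← fderiv_comp_add_right]
  simp_rw [hp k]

theorem per_lip {G : (Fin d → ℝ) → (Fin d → ℝ)} (hG : ContDiff ℝ 1 G) (hp : PerQ G) :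
    ∃ (K : ℝ≥0) (C : ℝ), LipschitzWith K G ∧ ∀ q, ‖G q‖ ≤ C := by
  obtain ⟨C, hC⟩ := per_bounded hG.continuous hp
  obtain ⟨L, hL⟩ := per_bounded (hG.continuous_fderiv (by simp)) (per_fderiv hp)
  refine ⟨L.toNNReal, C, ?_, hC⟩
  refine lipschitzWith_of_nnnorm_fderiv_le (𝕜 := ℝ) (hG.differentiable (by simp)) fun q => ?_
  rw [← NNReal.coe_le_coe, coe_nnnorm]
  exact (hL q).trans (Real.le_coe_toNNReal L)

/-- The drift force `-∇V₀`. -/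
noncomputable def force0 (V0 : (Fin d → ℝ) → ℝ) (q : Fin d → ℝ) : Fin d → ℝ :=
  fun i => -(fderiv ℝ V0 q (Pi.single i 1))

/-- The control force. -/
noncomputable def forceU (u : Fin d → ℝ × ℝ) (q : Fin d → ℝ) : Fin d → ℝ :=
  fun l => ∑ j, ((u j).1 * Real.sin (∑ i, kvec d j i * q i) -
    (u j).2 * Real.cos (∑ i, kvec d j i * q i)) * kvec d j l

/-- Smooth periodic potentials. -/
structure VHyp (V0 : (Fin d → ℝ) → ℝ) : Prop where
  smooth : ContDiff ℝ (⊤ : ℕ∞) V0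
  per : ∀ (q : Fin d → ℝ) (k : Fin d → ℤ), V0 (fun i => q i + 2 * Real.pi * (k i)) = V0 q

theorem hamVF_eq {V0 : (Fin d → ℝ) → ℝ} (hV : VHyp V0) (u : Fin d → ℝ × ℝ) :
    hamVF (torusHam V0 u) = mechX (fun q => force0 V0 q + forceU u q) := by
  have hVd : Differentiable ℝ V0 := hV.smooth.differentiable (by simp)
  have hd : Differentiable ℝ (torusHam V0 u) := by
    unfold torusHam
    fun_prop
  funext x
  refine Prod.ext ?_ ?_
  · funext i
    simp only [hamVF, mechX]
    rw [← (hd x).lineDeriv_eq_fderiv]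
    have h1 : ∀ j, HasDerivAt (fun t : ℝ => (x.2 j + t * (Pi.single i (1:ℝ) : Fin d → ℝ) j) ^ 2)
        (2 * x.2 j * (Pi.single i (1:ℝ) : Fin d → ℝ) j) 0 := by
      intro j
      have := (((hasDerivAt_id (0:ℝ)).mul_const ((Pi.single i (1:ℝ) : Fin d → ℝ) j)).const_add
        (x.2 j)).pow 2
      refine this.congr_deriv ?_
      simp
    have h2 := ((HasDerivAt.fun_sum (u := Finset.univ) fun j _ => h1 j).div_const 2).add_const
      (V0 x.1 + ∑ j, ((u j).1 * Real.cos (∑ i, kvec d j i * x.1 i) +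
          (u j).2 * Real.sin (∑ i, kvec d j i * x.1 i)))
    have h3 : HasLineDerivAt ℝ (torusHam V0 u) (x.2 i) x (0, Pi.single i 1) := by
      unfold HasLineDerivAt torusHam
      convert h2 using 1
      · funext t; simp [add_assoc]
      · simp [Pi.single_apply]
    exact h3.lineDeriv
  · funext i
    simp only [hamVF, mechX]
    rw [← (hd x).lineDeriv_eq_fderiv]
    have hl : HasDerivAt (fun t : ℝ => x.1 + t • (Pi.single i (1:ℝ) : Fin d → ℝ))
        (Pi.single i (1:ℝ)) 0 := by
      have := ((hasDerivAt_id (0:ℝ)).smul_const (Pi.single i (1:ℝ) : Fin d → ℝ)).const_add x.1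
      exact this.congr_deriv (by simp)
    have h0 : HasDerivAt (fun t : ℝ => V0 (x.1 + t • (Pi.single i (1:ℝ) : Fin d → ℝ)))
        (fderiv ℝ V0 x.1 (Pi.single i 1)) 0 := by
      have h := (hVd (x.1 + (0:ℝ) • (Pi.single i (1:ℝ) : Fin d → ℝ))).hasFDerivAt.comp_hasDerivAt
        (0:ℝ) hl
      refine h.congr_deriv (by simp)
    have h1 : ∀ j, HasDerivAt (fun t : ℝ => ∑ l, kvec d j l *
        (x.1 + t • (Pi.single i (1:ℝ) : Fin d → ℝ)) l) (kvec d j i) 0 := by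
      intro j
      have := HasDerivAt.fun_sum (u := Finset.univ) fun l _ =>
        ((hasDerivAt_pi.1 hl l).const_mul (kvec d j l))
      refine this.congr_deriv ?_
      simp [Pi.single_apply]
    have h2 := HasDerivAt.fun_sum (u := Finset.univ) fun j _ =>
      ((h1 j).cos.const_mul (u j).1).fun_add ((h1 j).sin.const_mul (u j).2)
    have h4 := ((h0.const_add ((∑ i, (x.2 i) ^ 2) / 2)).fun_add h2)
    have h5 := h4.congr_of_eventuallyEq
      (f₁ := fun t : ℝ => torusHam V0 u (x + t • ((Pi.single i 1, 0) : Phase d)))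
      (Eventually.of_forall fun t => by simp [torusHam])
    rw [lineDeriv, h5.deriv]
    simp only [force0, forceU, Pi.add_apply]
    rw [neg_add, ← Finset.sum_neg_distrib]
    congr 1
    refine Finset.sum_congr rfl fun j _ => ?_
    simp
    ring

theorem force0_per {V0 : (Fin d → ℝ) → ℝ} (hV : VHyp V0) : PerQ (force0 V0) := by
  intro k q
  have h : fderiv ℝ V0 (q + (latt k).1) = fderiv ℝ V0 q := by
    rw [← fderiv_comp_add_right]
    congr 1
    funext q
    exact hV.per q k
  funext i
  simp only [force0, h]

theorem force0_smooth {V0 : (Fin d → ℝ) → ℝ} (hV : VHyp V0) : ContDiff ℝ 1 (force0 V0) := by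
  unfold force0
  rw [contDiff_pi]
  intro i
  have h : ContDiff ℝ 1 (fderiv ℝ V0) := hV.smooth.fderiv_right (by norm_cast)
  exact (h.clm_apply contDiff_const).neg

/-- Integer version of `kvec`. -/
def kvecZ (d : ℕ) (j : Fin d) : Fin d → ℤ :=
  if (j : ℕ) < d - 1 then Pi.single j 1 else fun _ => 1

theorem kvec_cast (j i : Fin d) : kvec d j i = (kvecZ d j i : ℝ) := by
  unfold kvec kvecZ
  split_ifs
  · simp [Pi.single_apply]
  · simp

/-- Phase of a wave. -/
def dotp (k : Fin d → ℤ) (q : Fin d → ℝ) : ℝ := ∑ i, (k i : ℝ) * q i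

theorem dotp_latt (k l : Fin d → ℤ) (q : Fin d → ℝ) :
    dotp k (q + (latt l).1) = dotp k q + (∑ i, k i * l i : ℤ) * (2 * π) := by
  simp only [dotp, latt, Pi.add_apply, mul_add, Finset.sum_add_distrib]
  push_cast
  rw [Finset.sum_mul]
  congr 1
  exact Finset.sum_congr rfl fun i _ => by ring

/-- A travelling wave force. -/
noncomputable def wave (k : Fin d → ℤ) (θ s : ℝ) (q : Fin d → ℝ) : Fin d → ℝ :=
  fun i => s * Real.sin (dotp k q + θ) * k i

theorem wave_per (k : Fin d → ℤ) (θ s : ℝ) : PerQ (wave k θ s) := by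
  intro l q
  funext i
  simp only [wave, dotp_latt]
  have : dotp k q + (∑ i, k i * l i : ℤ) * (2 * π) + θ =
    dotp k q + θ + (∑ i, k i * l i : ℤ) * (2 * π) := by ring
  rw [this, Real.sin_add_int_mul_two_pi]

theorem wave_smooth (k : Fin d → ℤ) (θ s : ℝ) : ContDiff ℝ 1 (wave k θ s) := by
  unfold wave dotp
  fun_prop

theorem forceU_eq_sum (u : Fin d → ℝ × ℝ) (q : Fin d → ℝ) : forceU u q =
    ∑ j, (wave (kvecZ d j) 0 (u j).1 q + wave (kvecZ d j) (π / 2) (-(u j).2) q) := by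
  funext l
  simp only [forceU, Finset.sum_apply, Pi.add_apply, wave, Real.sin_add_pi_div_two, dotp,
    kvec_cast, add_zero]
  exact Finset.sum_congr rfl fun i _ => by ring

theorem forceU_per (u : Fin d → ℝ × ℝ) : PerQ (forceU u) := by
  intro l q
  simp only [forceU_eq_sum, wave_per _ _ _ l q]

theorem forceU_smooth (u : Fin d → ℝ × ℝ) : ContDiff ℝ 1 (forceU u) := by
  have : forceU u = fun q => ∑ j, (wave (kvecZ d j) 0 (u j).1 q +
      wave (kvecZ d j) (π / 2) (-(u j).2) q) := funext (forceU_eq_sum u)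
  rw [this]
  exact ContDiff.sum fun j _ => (wave_smooth _ _ _).add (wave_smooth _ _ _)

theorem forceU_smul (c : ℝ) (u : Fin d → ℝ × ℝ) (q : Fin d → ℝ) :
    forceU (c • u) q = c • forceU u q := by
  funext l
  simp only [forceU, Pi.smul_apply, Prod.smul_fst, Prod.smul_snd, smul_eq_mul, Finset.mul_sum]
  exact Finset.sum_congr rfl fun i _ => by ring

theorem forceU_single (j : Fin d) (θ s : ℝ) (q : Fin d → ℝ) :
    forceU (Pi.single j (s * Real.cos θ, -(s * Real.sin θ))) q = wave (kvecZ d j) θ s q := by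
  funext l
  simp only [forceU]
  rw [Finset.sum_eq_single j]
  · simp only [Pi.single_eq_same, wave, dotp, kvec_cast, Real.sin_add]
    ring
  · intro i _ hi
    simp [Pi.single_eq_of_ne hi]
  · simp

theorem force_exists_flow {V0 : (Fin d → ℝ) → ℝ} (hV : VHyp V0) (u : Fin d → ℝ × ℝ) :
    ∃ φ, IsFlowOf (hamVF (torusHam V0 u)) φ := by
  rw [hamVF_eq hV]
  have hs := (force0_smooth hV).add (forceU_smooth u)
  have hp : PerQ (fun q => force0 V0 q + forceU u q) := fun k q => by
    simp only [force0_per hV k q, forceU_per u k q]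
  obtain ⟨K, C, hK, hC⟩ := per_lip hs hp
  exact mechX_exists_flow hs hK hC

theorem force_flow_good {V0 : (Fin d → ℝ) → ℝ} (hV : VHyp V0) {u : Fin d → ℝ × ℝ}
    {φ : ℝ → Phase d → Phase d} (hφ : IsFlowOf (hamVF (torusHam V0 u)) φ) {t : ℝ} (ht : 0 ≤ t) :
    Good (φ t) := by
  rw [hamVF_eq hV] at hφ
  have hs := (force0_smooth hV).add (forceU_smooth u)
  have hp : PerQ (fun q => force0 V0 q + forceU u q) := fun k q => by
    simp only [force0_per hV k q, forceU_per u k q]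
  obtain ⟨K, C, hK, hC⟩ := per_lip hs hp
  exact flow_good hK hC hp hφ ht

end force

section reach
variable {d : ℕ}

theorem foldl_comp {α : Type*} (l : List (α → α)) (g : α → α) :
    l.foldl (fun g f => f ∘ g) g = l.foldl (fun g f => f ∘ g) id ∘ g := by
  induction l generalizing g with
  | nil => rfl
  | cons a l ih =>
    simp only [List.foldl_cons]
    rw [ih (a ∘ g), ih (a ∘ id)]
    rfl

theorem foldl_good (l : List (Phase d → Phase d)) (h : ∀ f ∈ l, Good f) :
    Good (l.foldl (fun g f => f ∘ g) id) := by
  induction l with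
  | nil => exact good_id
  | cons a l ih =>
    simp only [List.foldl_cons]
    rw [foldl_comp]
    exact (ih fun f hf => h f (by simp [hf])).comp ((h a (by simp)).comp good_id)

theorem Reachable.good {V0 : (Fin d → ℝ) → ℝ} (hV : VHyp V0) {τ : ℝ} {Φ : Phase d → Phase d}
    (h : Reachable (torusHam V0) τ Φ) : Good Φ := by
  obtain ⟨n, dur, u, φ, h0, -, hf, rfl⟩ := h
  apply foldl_good
  intro f hf'
  rw [List.mem_ofFn] at hf'
  obtain ⟨i, rfl⟩ := hf'
  exact force_flow_good hV (hf i) (h0 i)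

theorem Reachable.comp {U : Type*} {Ham : U → Phase d → ℝ} {τ₁ τ₂ : ℝ}
    {Φ₁ Φ₂ : Phase d → Phase d}
    (h1 : Reachable Ham τ₁ Φ₁) (h2 : Reachable Ham τ₂ Φ₂) : Reachable Ham (τ₁ + τ₂) (Φ₂ ∘ Φ₁) := by
  obtain ⟨n, dur, u, φ, h0, hs, hf, rfl⟩ := h1
  obtain ⟨n', dur', u', φ', h0', hs', hf', rfl⟩ := h2
  refine ⟨n + n', Fin.append dur dur', Fin.append u u', Fin.append φ φ', ?_, ?_, ?_, ?_⟩
  · intro i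
    refine Fin.addCases (fun i => ?_) (fun i => ?_) i
    · simpa using h0 i
    · simpa using h0' i
  · rw [Fin.sum_univ_add]
    simp [hs, hs']
  · intro i
    refine Fin.addCases (fun i => ?_) (fun i => ?_) i
    · simpa using hf i
    · simpa using hf' i
  · have : (fun i => Fin.append φ φ' i (Fin.append dur dur' i)) =
        Fin.append (fun i => φ i (dur i)) (fun i => φ' i (dur' i)) := by
      funext i
      refine Fin.addCases (fun i => ?_) (fun i => ?_) i
      · simp
      · simp
    rw [this, List.ofFn_fin_append, List.foldl_append]
    exact (foldl_comp _ _).symm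

theorem Reachable.flow {U : Type*} {Ham : U → Phase d → ℝ} {u : U} {φ : ℝ → Phase d → Phase d}
    (h : IsFlowOf (hamVF (Ham u)) φ) {τ : ℝ} (hτ : 0 ≤ τ) : Reachable Ham τ (φ τ) :=
  ⟨1, fun _ => τ, fun _ => u, fun _ => φ, fun _ => hτ, by simp, fun _ => h, by simp⟩

/-- `F` is approximable on densities within time `δ`. -/
def Appr (V0 : (Fin d → ℝ) → ℝ) (r δ : ℝ) (F : Phase d → Phase d) : Prop :=
  Good F ∧ ∀ ρ : Phase d → ℝ, IsTorusDensity (ENNReal.ofReal r) ρ → ∀ ε > (0:ℝ),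
    ∃ τ ∈ Set.Icc (0:ℝ) δ, ∃ Φ : Phase d → Phase d, Reachable (torusHam V0) τ Φ ∧
      eLpNorm (fun x => ρ (Φ x) - ρ (F x)) (ENNReal.ofReal r)
          (volume.restrict (torusBlock d)) < ENNReal.ofReal ε

/-- `F` is approximable on densities in arbitrarily small time. -/
def ApprS (V0 : (Fin d → ℝ) → ℝ) (r : ℝ) (F : Phase d → Phase d) : Prop :=
  ∀ δ > 0, Appr V0 r δ F

theorem Appr.flow {V0 : (Fin d → ℝ) → ℝ} (hV : VHyp V0) {r : ℝ} {u : Fin d → ℝ × ℝ}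
    {φ : ℝ → Phase d → Phase d} (hφ : IsFlowOf (hamVF (torusHam V0 u)) φ) {t δ : ℝ} (ht : 0 ≤ t)
    (hδ : t ≤ δ) : Appr V0 r δ (φ t) := by
  refine ⟨force_flow_good hV hφ ht, fun ρ _ ε hε => ⟨t, ⟨ht, hδ⟩, φ t, Reachable.flow hφ ht, ?_⟩⟩
  simpa using hε

theorem Appr.comp {V0 : (Fin d → ℝ) → ℝ} (hV : VHyp V0) {r : ℝ} (hr : 1 ≤ r) {δ₁ δ₂ : ℝ}
    {F G : Phase d → Phase d} (hF : Appr V0 r δ₁ F) (hG : Appr V0 r δ₂ G) :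
    Appr V0 r (δ₁ + δ₂) (F ∘ G) := by
  refine ⟨hF.1.comp hG.1, fun ρ hρ ε hε => ?_⟩
  have hρF := density_comp hr hρ hF.1
  obtain ⟨τ₂, ⟨h20, h2δ⟩, Φ₂, hR2, hE2⟩ := hG.2 _ hρF (ε / 2) (by linarith)
  obtain ⟨τ₁, ⟨h10, h1δ⟩, Φ₁, hR1, hE1⟩ := hF.2 ρ hρ (ε / 2) (by linarith)
  refine ⟨τ₁ + τ₂, ⟨by linarith, by linarith⟩, Φ₁ ∘ Φ₂, ?_, ?_⟩
  · rw [add_comm]; exact hR2.comp hR1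
  have g1 := hR1.good hV
  have g2 := hR2.good hV
  have hp1 : 1 ≤ ENNReal.ofReal r := by simpa using hr
  have hm : Measurable fun x => ρ (Φ₁ x) - ρ (F x) :=
    (hρ.1.comp g1.meas).sub (hρ.1.comp hF.1.meas)
  have hper : PerFun fun x => ρ (Φ₁ x) - ρ (F x) := fun k x => by
    simp only [g1.equi, hF.1.equi, density_per hρ k]
  have hE1' := (g2.eLpNorm_le hr hm hper).trans_lt hE1
  have heq : (fun x => ρ ((Φ₁ ∘ Φ₂) x) - ρ ((F ∘ G) x)) =
      (fun x => ρ (Φ₁ (Φ₂ x)) - ρ (F (Φ₂ x))) + fun x => ρ (F (Φ₂ x)) - ρ (F (G x)) := by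
    ext x; simp
  rw [heq]
  refine (eLpNorm_add_le (hm.comp g2.meas).aestronglyMeasurable
    ((hρF.1.comp g2.meas).sub (hρF.1.comp hG.1.meas)).aestronglyMeasurable hp1).trans_lt ?_
  refine (ENNReal.add_lt_add hE1' hE2).trans_le ?_
  rw [← ENNReal.ofReal_add (by linarith) (by linarith)]
  simp

theorem ApprS.comp {V0 : (Fin d → ℝ) → ℝ} (hV : VHyp V0) {r : ℝ} (hr : 1 ≤ r)
    {F G : Phase d → Phase d} (hF : ApprS V0 r F) (hG : ApprS V0 r G) : ApprS V0 r (F ∘ G) := by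
  intro δ hδ
  have := (hF (δ / 2) (by linarith)).comp hV hr (hG (δ / 2) (by linarith))
  simpa using this

theorem ApprS.of_tendsto {V0 : (Fin d → ℝ) → ℝ} (hV : VHyp V0) {r : ℝ} (hr : 1 ≤ r)
    {F : ℕ → Phase d → Phase d} {G : Phase d → Phase d} (hG : Good G) (hmp : MeasurePreserving G)
    (hF : ∀ δ > 0, ∀ᶠ n in atTop, Appr V0 r δ (F n))
    (hlim : ∀ᵐ x, Tendsto (fun n => F n x) atTop (𝓝 (G x))) : ApprS V0 r G := by
  intro δ hδ
  refine ⟨hG, fun ρ hρ ε hε => ?_⟩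
  obtain ⟨N, hN⟩ := eventually_atTop.1 (hF δ hδ)
  have hl := limit_lemma (F := fun n => F (n + N)) (fun n => (hN _ (by omega)).1) hG hmp (by
    filter_upwards [hlim] with x hx
    exact hx.comp (tendsto_add_atTop_nat N)) hr hρ
  have hε2 : (0 : ENNReal) < ENNReal.ofReal (ε / 2) := by simpa using hε
  obtain ⟨n, hn⟩ := ((ENNReal.tendsto_nhds_zero.1 hl) _ hε2).exists
  obtain ⟨τ, hτ, Φ, hR, hE⟩ := (hN (n + N) (by omega)).2 ρ hρ (ε / 2) (by linarith)
  refine ⟨τ, hτ, Φ, hR, ?_⟩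
  have hgn := (hN (n + N) (by omega)).1
  have gn := hgn.meas
  have hp1 : 1 ≤ ENNReal.ofReal r := by simpa using hr
  have gΦ := (hR.good hV).meas
  have heq : (fun x => ρ (Φ x) - ρ (G x)) =
      (fun x => ρ (Φ x) - ρ (F (n + N) x)) + fun x => ρ (F (n + N) x) - ρ (G x) := by
    ext x; simp
  rw [heq]
  refine (eLpNorm_add_le ((hρ.1.comp gΦ).sub (hρ.1.comp gn)).aestronglyMeasurable
    ((hρ.1.comp gn).sub (hρ.1.comp hG.meas)).aestronglyMeasurable hp1).trans_lt ?_
  refine (ENNReal.add_lt_add_of_lt_of_le (hn.trans_lt ENNReal.ofReal_lt_top).ne hE hn).trans_le ?_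
  rw [← ENNReal.ofReal_add (by linarith) (by linarith)]
  simp

end reach

section kicks
variable {d : ℕ} {V0 : (Fin d → ℝ) → ℝ} {r : ℝ}

/-- The vertical kick by `G` is approximable. -/
structure PK (V0 : (Fin d → ℝ) → ℝ) (r : ℝ) (G : (Fin d → ℝ) → (Fin d → ℝ)) : Prop where
  meas : Measurable G
  per : PerQ G
  appr : ApprS V0 r (kick G)

theorem PK.zero : PK V0 r (fun _ => 0) := by
  refine ⟨measurable_const, fun _ _ => rfl, fun δ hδ => ?_⟩
  have h : kick (fun _ : Fin d → ℝ => (0 : Fin d → ℝ)) = id := by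
    funext x; simp [kick]
  rw [h]
  refine ⟨good_id, fun ρ _ ε hε => ⟨0, ⟨le_rfl, hδ.le⟩, id, ?_, ?_⟩⟩
  · exact ⟨0, Fin.elim0, Fin.elim0, Fin.elim0, fun i => i.elim0, by simp, fun i => i.elim0, by simp⟩
  · simpa using hε

theorem PK.add (hV : VHyp V0) (hr : 1 ≤ r) {G₁ G₂ : (Fin d → ℝ) → (Fin d → ℝ)}
    (h1 : PK V0 r G₁) (h2 : PK V0 r G₂) : PK V0 r (fun q => G₁ q + G₂ q) := by
  refine ⟨h1.meas.add h2.meas, fun k q => by simp only [h1.per k q, h2.per k q], ?_⟩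
  have h : kick (fun q => G₁ q + G₂ q) = kick G₁ ∘ kick G₂ := by
    funext x; simp only [kick, Function.comp]; rw [add_assoc, add_comm (G₁ _)]
  rw [h]
  exact h1.appr.comp hV hr h2.appr

theorem PK.sum (hV : VHyp V0) (hr : 1 ≤ r) {ι : Type*} (s : Finset ι)
    {G : ι → (Fin d → ℝ) → (Fin d → ℝ)}
    (h : ∀ i ∈ s, PK V0 r (G i)) : PK V0 r (fun q => ∑ i ∈ s, G i q) := by
  classical
  induction s using Finset.induction_on with
  | empty => simpa using PK.zero
  | insert a s ha ih =>
    simp only [Finset.sum_insert ha]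
    exact (h a (by simp)).add hV hr (ih fun i hi => h i (by simp [hi]))

theorem PK.of_tendsto (hV : VHyp V0) (hr : 1 ≤ r) {G : ℕ → (Fin d → ℝ) → (Fin d → ℝ)}
    {H : (Fin d → ℝ) → (Fin d → ℝ)} (hm : Measurable H) (hp : PerQ H)
    (hG : ∀ n, PK V0 r (G n))
    (hlim : ∀ᵐ x : Phase d, Tendsto (fun n => G n x.1) atTop (𝓝 (H x.1))) : PK V0 r H := by
  refine ⟨hm, hp, ApprS.of_tendsto hV hr (F := fun n => kick (G n)) (kick_good hm hp) (kick_mp hm)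
    (fun δ hδ => Eventually.of_forall fun n => (hG n).appr δ hδ) ?_⟩
  filter_upwards [hlim] with x hx
  exact tendsto_const_nhds.prodMk_nhds (tendsto_const_nhds.add hx)

/-- The small parameter. -/
noncomputable def eps (n : ℕ) : ℝ := 1 / ((n : ℝ) + 1)

theorem eps_pos (n : ℕ) : 0 < eps n := by unfold eps; positivity

theorem eps_lim : Tendsto eps atTop (𝓝 0) := tendsto_one_div_add_atTop_nhds_zero_nat

theorem PK.wave_basic (hV : VHyp V0) (hr : 1 ≤ r) (j : Fin d) (θ s : ℝ) :
    PK V0 r (wave (kvecZ d j) θ s) := by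
  set u : Fin d → ℝ × ℝ := Pi.single j (s * Real.cos θ, -(s * Real.sin θ)) with hu
  have hm : Measurable (wave (kvecZ d j) θ s) := (wave_smooth _ _ _).continuous.measurable
  refine ⟨hm, wave_per _ _ _, ?_⟩
  obtain ⟨K0, C0, hK0, hC0⟩ := per_lip (force0_smooth hV) (force0_per hV)
  obtain ⟨K1, C1, hK1, hC1⟩ := per_lip (forceU_smooth u) (forceU_per u)
  choose φ hφ using fun n : ℕ => force_exists_flow hV ((eps n)⁻¹ • u)
  refine ApprS.of_tendsto hV hr (F := fun n => φ n (eps n)) (kick_good hm (wave_per _ _ _))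
    (kick_mp hm) (fun δ hδ => ?_) (Eventually.of_forall fun x => ?_)
  · filter_upwards [eps_lim.eventually (gt_mem_nhds hδ)] with n hn
    exact Appr.flow hV (hφ n) (eps_pos n).le hn.le
  have hfl : ∀ n t, HasDerivAt (fun s => φ n s x)
      (mechX (fun q => force0 V0 q + (eps n)⁻¹ • forceU u q) (φ n t x)) t := by
    intro n t
    have := (hφ n).2 x t
    rw [hamVF_eq hV] at this
    simpa only [forceU_smul] using this
  have hbd : ∀ n q, ‖force0 V0 q + (eps n)⁻¹ • forceU u q‖ ≤ C0 + (eps n)⁻¹ * C1 := by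
    intro n q
    refine (norm_add_le _ _).trans (add_le_add (hC0 q) ?_)
    rw [norm_smul, Real.norm_of_nonneg (inv_pos.2 (eps_pos n)).le]
    exact mul_le_mul_of_nonneg_left (hC1 q) (inv_pos.2 (eps_pos n)).le
  have hlip : ∀ n, LipschitzWith (K0 + ‖(eps n)⁻¹‖₊ * K1)
      (fun q => force0 V0 q + (eps n)⁻¹ • forceU u q) := fun n =>
    hK0.add ((lipschitzWith_smul ((eps n)⁻¹)).comp hK1)
  have hx0 : ∀ n, φ n 0 x = x := fun n => (hφ n).1 x
  have e1 : ∀ n, ‖(φ n (eps n) x).1 - x.1‖ ≤ eps n * ‖x.2‖ + (C0 * eps n ^ 2 + C1 * eps n) := by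
    intro n
    have := curve_est_q (hbd n) (hfl n) (eps_pos n).le
    simp only [hx0] at this
    refine this.trans (le_of_eq ?_)
    have := (eps_pos n).ne'
    field_simp
  have e2 : ∀ n, ‖(φ n (eps n) x).2 - x.2 - (eps n • force0 V0 x.1 + forceU u x.1)‖ ≤
      (K0 * eps n + K1) * (eps n * ‖x.2‖ + (C0 * eps n ^ 2 + C1 * eps n)) := by
    intro n
    have := curve_est_c (hlip n) (hbd n) (hfl n) (eps_pos n).le
    simp only [hx0] at this
    have hne := (eps_pos n).ne'
    rw [smul_add, smul_smul, mul_inv_cancel₀ hne, one_smul] at this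
    refine this.trans (le_of_eq ?_)
    push_cast
    rw [Real.norm_of_nonneg (inv_pos.2 (eps_pos n)).le]
    field_simp
  have hw : forceU u x.1 = wave (kvecZ d j) θ s x.1 := forceU_single j θ s x.1
  have l1 : Tendsto (fun n => (φ n (eps n) x).1) atTop (𝓝 x.1) := by
    rw [tendsto_iff_norm_sub_tendsto_zero]
    refine squeeze_zero (fun _ => norm_nonneg _) e1 ?_
    have := ((by fun_prop : Continuous fun e : ℝ => e * ‖x.2‖ + (C0 * e ^ 2 + C1 * e)).tendsto
      0).comp eps_lim
    simpa [Function.comp_def] using this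
  have l2 : Tendsto (fun n => (φ n (eps n) x).2) atTop (𝓝 (x.2 + wave (kvecZ d j) θ s x.1)) := by
    have h0 : Tendsto (fun n => (φ n (eps n) x).2 - x.2 - (eps n • force0 V0 x.1 + forceU u x.1))
        atTop (𝓝 0) := by
      refine squeeze_zero_norm e2 ?_
      have := ((by fun_prop : Continuous fun e : ℝ =>
        (K0 * e + K1) * (e * ‖x.2‖ + (C0 * e ^ 2 + C1 * e))).tendsto 0).comp eps_lim
      simpa [Function.comp_def] using this
    have h1 : Tendsto (fun n => x.2 + (eps n • force0 V0 x.1 + forceU u x.1)) atTop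
        (𝓝 (x.2 + wave (kvecZ d j) θ s x.1)) := by
      have := ((by fun_prop : Continuous fun e : ℝ =>
        x.2 + (e • force0 V0 x.1 + forceU u x.1)).tendsto 0).comp eps_lim
      simpa [Function.comp_def, hw] using this
    have h2 := h0.add h1
    rw [zero_add] at h2
    refine h2.congr fun n => ?_
    abel
  exact l1.prodMk_nhds l2

theorem PK.saturate (hV : VHyp V0) (hr : 1 ≤ r) {G : (Fin d → ℝ) → (Fin d → ℝ)}
    (hG : ContDiff ℝ 1 G) (h : ∀ c : ℝ, PK V0 r (fun q => c • G q)) :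
    PK V0 r (fun q => -(fderiv ℝ G q (G q))) := by
  have hGp : PerQ G := by simpa using (h 1).per
  have hm : Measurable (fun q => -(fderiv ℝ G q (G q))) :=
    (((hG.continuous_fderiv (by simp)).clm_apply hG.continuous).neg).measurable
  have hp : PerQ (fun q => -(fderiv ℝ G q (G q))) := fun k q => by
    simp only [hGp k q, per_fderiv hGp k q]
  refine ⟨hm, hp, ?_⟩
  obtain ⟨K0, C0, hK0, hC0⟩ := per_lip (force0_smooth hV) (force0_per hV)
  obtain ⟨φ, hφ⟩ := force_exists_flow hV (0 : Fin d → ℝ × ℝ)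
  refine ApprS.of_tendsto hV hr (F := fun n => kick (fun q => (-(eps n)⁻¹) • G q) ∘
    (φ (eps n ^ 2) ∘ kick (fun q => (eps n)⁻¹ • G q))) (kick_good hm hp)
    (kick_mp hm) (fun δ hδ => ?_) (Eventually.of_forall fun x => ?_)
  · have hl : Tendsto (fun n => eps n ^ 2) atTop (𝓝 0) := by simpa using eps_lim.pow 2
    filter_upwards [hl.eventually (gt_mem_nhds (show 0 < δ / 3 by linarith))] with n hn
    have := ((h (-(eps n)⁻¹)).appr (δ / 3) (by linarith)).comp hV hr
      ((Appr.flow hV hφ (by positivity) hn.le).comp hV hr ((h ((eps n)⁻¹)).appr (δ / 3)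
        (by linarith)))
    have h3 : δ / 3 + (δ / 3 + δ / 3) = δ := by ring
    rw [h3] at this
    exact this
  have hfl : ∀ y t, HasDerivAt (fun s => φ s y) (mechX (force0 V0) (φ t y)) t := by
    intro y t
    have := hφ.2 y t
    rw [hamVF_eq hV] at this
    have h0 : ∀ q, forceU (0 : Fin d → ℝ × ℝ) q = 0 := fun q => by
      simpa using forceU_smul 0 (0 : Fin d → ℝ × ℝ) q
    simpa only [h0, add_zero] using this
  set y : ℕ → Phase d := fun n => (x.1, x.2 + (eps n)⁻¹ • G x.1) with hy
  set z : ℕ → Phase d := fun n => φ (eps n ^ 2) (y n) with hz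
  have hFn : ∀ n, (kick (fun q => (-(eps n)⁻¹) • G q) ∘
    (φ (eps n ^ 2) ∘ kick (fun q => (eps n)⁻¹ • G q))) x =
      ((z n).1, (z n).2 + (-(eps n)⁻¹) • G (z n).1) := fun n => rfl
  simp only [hFn]
  have ea : ∀ n, ‖(z n).2 - (x.2 + (eps n)⁻¹ • G x.1)‖ ≤ C0 * eps n ^ 2 := fun n => by
    have := curve_est_a hC0 (hfl (y n)) (t := eps n ^ 2) (by positivity)
    simpa only [hφ.1] using this
  have eb : ∀ n, ‖(eps n)⁻¹ • ((z n).1 - x.1) - (G x.1 + eps n • x.2)‖ ≤ C0 * eps n ^ 3 := fun n => by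
    have := curve_est_b hC0 (hfl (y n)) (t := eps n ^ 2) (by positivity)
    simp only [hφ.1] at this
    have hne := (eps_pos n).ne'
    have hid : (eps n)⁻¹ • ((z n).1 - x.1) - (G x.1 + eps n • x.2) =
        (eps n)⁻¹ • ((z n).1 - x.1 - (eps n ^ 2) • (x.2 + (eps n)⁻¹ • G x.1)) := by
      ext i
      simp only [Pi.sub_apply, Pi.smul_apply, Pi.add_apply, smul_eq_mul]
      field_simp
      ring
    rw [hid, norm_smul, Real.norm_of_nonneg (inv_pos.2 (eps_pos n)).le, inv_mul_le_iff₀ (eps_pos n)]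
    refine this.trans (le_of_eq ?_)
    ring
  have lb : Tendsto (fun n => (eps n)⁻¹ • ((z n).1 - x.1)) atTop (𝓝 (G x.1)) := by
    have h0 : Tendsto (fun n => (eps n)⁻¹ • ((z n).1 - x.1) - (G x.1 + eps n • x.2)) atTop (𝓝 0) := by
      refine squeeze_zero_norm eb ?_
      simpa using (eps_lim.pow 3).const_mul C0
    have h1 : Tendsto (fun n => G x.1 + eps n • x.2) atTop (𝓝 (G x.1)) := by
      simpa using (eps_lim.smul_const x.2).const_add (G x.1)
    have h2 := h0.add h1
    rw [zero_add] at h2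
    exact h2.congr fun n => by abel
  have lq : Tendsto (fun n => (z n).1 - x.1) atTop (𝓝 0) := by
    have := eps_lim.smul lb
    rw [zero_smul] at this
    refine this.congr fun n => ?_
    rw [smul_smul, mul_inv_cancel₀ (eps_pos n).ne', one_smul]
  have lG : Tendsto (fun n => (eps n)⁻¹ • (G (z n).1 - G x.1)) atTop
      (𝓝 (fderiv ℝ G x.1 (G x.1))) := by
    have hd := (hG.differentiable (by simp) x.1).hasFDerivAt.hasFDerivWithinAt (s := Set.univ)
    have := hd.lim lq (Eventually.of_forall fun _ => Set.mem_univ _) lb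
    simpa using this
  have l1 : Tendsto (fun n => (z n).1) atTop (𝓝 x.1) := by
    simpa using lq.add_const x.1
  have l2 : Tendsto (fun n => (z n).2 + (-(eps n)⁻¹) • G (z n).1) atTop
      (𝓝 (x.2 + -(fderiv ℝ G x.1 (G x.1)))) := by
    have h0 : Tendsto (fun n => (z n).2 - (x.2 + (eps n)⁻¹ • G x.1)) atTop (𝓝 0) := by
      refine squeeze_zero_norm ea ?_
      simpa using (eps_lim.pow 2).const_mul C0
    have h1 := h0.add (lG.neg.const_add x.2)
    rw [zero_add] at h1
    refine h1.congr fun n => ?_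
    rw [smul_sub, neg_smul]
    abel
  exact l1.prodMk_nhds l2

end kicks

section freq
variable {d : ℕ} {V0 : (Fin d → ℝ) → ℝ} {r : ℝ}

/-- All waves of frequency `k` are approximable. -/
def Freq (V0 : (Fin d → ℝ) → ℝ) (r : ℝ) (k : Fin d → ℤ) : Prop := ∀ θ s, PK V0 r (wave k θ s)

theorem wave_fderiv (k : Fin d → ℤ) (θ s : ℝ) (q v : Fin d → ℝ) :
    fderiv ℝ (wave k θ s) q v = fun i => s * (Real.cos (dotp k q + θ) * dotp k v) * k i := by
  have hd : DifferentiableAt ℝ (wave k θ s) q := (wave_smooth k θ s).differentiable (by simp) q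
  rw [← hd.lineDeriv_eq_fderiv]
  apply HasLineDerivAt.lineDeriv
  unfold HasLineDerivAt
  rw [hasDerivAt_pi]
  intro i
  have h1 : HasDerivAt (fun t : ℝ => dotp k (q + t • v) + θ) (dotp k v) 0 := by
    have : (fun t : ℝ => dotp k (q + t • v) + θ) = fun t => t * dotp k v + (dotp k q + θ) := by
      funext t
      simp only [dotp, Pi.add_apply, Pi.smul_apply, smul_eq_mul, mul_add, Finset.sum_add_distrib,
        Finset.mul_sum]
      have : ∀ i, (k i : ℝ) * (t * v i) = t * (k i * v i) := fun i => by ring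
      simp only [this]
      ring
    rw [this]
    exact (((hasDerivAt_id (0:ℝ)).mul_const _).add_const _).congr_deriv (by simp)
  have h2 := ((h1.sin).const_mul s).mul_const (k i : ℝ)
  refine h2.congr_deriv ?_
  simp

theorem dotp_add (k : Fin d → ℤ) (a b : Fin d → ℝ) : dotp k (a + b) = dotp k a + dotp k b := by
  simp [dotp, mul_add, Finset.sum_add_distrib]

theorem dotp_wave (k l : Fin d → ℤ) (θ s : ℝ) (q : Fin d → ℝ) :
    dotp k (wave l θ s q) = s * Real.sin (dotp l q + θ) * dotp k (fun i => (l i : ℝ)) := by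
  simp only [dotp, wave, Finset.mul_sum]
  exact Finset.sum_congr rfl fun i _ => by ring

theorem dotp_addk (k l : Fin d → ℤ) (q : Fin d → ℝ) : dotp (k + l) q = dotp k q + dotp l q := by
  simp [dotp, add_mul, Finset.sum_add_distrib]

/-- Integer scalar product. -/
noncomputable abbrev ip (k l : Fin d → ℤ) : ℝ := dotp k (fun i => (l i : ℝ))

theorem ip_comm (k l : Fin d → ℤ) : ip k l = ip l k := by
  simp only [ip, dotp]
  exact Finset.sum_congr rfl fun i _ => by ring

theorem Freq.two (hV : VHyp V0) (hr : 1 ≤ r) {k : Fin d → ℤ} (hk : Freq V0 r k) (h0 : 0 < ip k k) :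
    Freq V0 r (k + k) := by
  have key : ∀ θ a, PK V0 r (wave (k + k) (2 * θ) (-(a ^ 2 * ip k k / 4))) := by
    intro θ a
    have h := PK.saturate hV hr (wave_smooth k θ a) (fun c => by
      have := hk θ (c * a)
      convert this using 2 with q
      funext i; simp [wave, mul_assoc])
    convert h using 2 with q
    funext i
    rw [wave_fderiv, dotp_wave]
    simp only [wave, dotp_addk, Pi.add_apply, Pi.neg_apply]
    have : dotp k q + dotp k q + 2 * θ = 2 * (dotp k q + θ) := by ring
    rw [this, Real.sin_two_mul]
    push_cast
    ring
  intro θ s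
  rcases le_total s 0 with hs | hs
  · have := key (θ / 2) (Real.sqrt (-s * 4 / ip k k))
    rw [Real.sq_sqrt (by apply div_nonneg _ h0.le; linarith)] at this
    convert this using 1
    congr 1
    · ring
    · field_simp
  · have := key ((θ + π) / 2) (Real.sqrt (s * 4 / ip k k))
    rw [Real.sq_sqrt (by apply div_nonneg _ h0.le; linarith)] at this
    convert this using 1
    funext q i
    have h1 : dotp (k + k) q + 2 * ((θ + π) / 2) = dotp (k + k) q + θ + π := by ring
    simp only [wave, h1, Real.sin_add_pi]
    field_simp

theorem Freq.neg {k : Fin d → ℤ} (hk : Freq V0 r k) : Freq V0 r (-k) := by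
  intro θ s
  convert hk (-θ) s using 1
  funext q i
  have : dotp (-k) q + θ = -(dotp k q + -θ) := by simp [dotp]; ring
  simp only [wave, this, Real.sin_neg]
  push_cast [Pi.neg_apply]
  ring

theorem Freq.add (hV : VHyp V0) (hr : 1 ≤ r) {k l : Fin d → ℤ} (hk : Freq V0 r k) (hl : Freq V0 r l)
    (hk0 : 0 < ip k k) (hl0 : 0 < ip l l) (hkl : ip k l ≠ 0) : Freq V0 r (k + l) := by
  have hkk := hk.two hV hr hk0
  have hll := hl.two hV hr hl0
  have key : ∀ θ φ a b, PK V0 r (fun q i => -(a * b * ip k l) *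
      (Real.cos (dotp k q + θ) * Real.sin (dotp l q + φ) * k i +
        Real.sin (dotp k q + θ) * Real.cos (dotp l q + φ) * l i)) := by
    intro θ φ a b
    have h := PK.saturate hV hr ((wave_smooth k θ a).add (wave_smooth l φ b)) (fun c => by
      have := (hk θ (c * a)).add hV hr (hl φ (c * b))
      convert this using 2 with q
      funext i; simp [wave]; ring)
    have h2 := (h.add hV hr (hkk (2 * θ) (a ^ 2 * ip k k / 4))).add hV hr
      (hll (2 * φ) (b ^ 2 * ip l l / 4))
    convert h2 using 2 with q
    funext i
    have hd1 : DifferentiableAt ℝ (wave k θ a) q := (wave_smooth k θ a).differentiable (by simp) q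
    have hd2 : DifferentiableAt ℝ (wave l φ b) q := (wave_smooth l φ b).differentiable (by simp) q
    have hf : fderiv ℝ (fun q => wave k θ a q + wave l φ b q) q =
      fderiv ℝ (wave k θ a) q + fderiv ℝ (wave l φ b) q := fderiv_fun_add hd1 hd2
    rw [hf, _root_.add_apply, wave_fderiv, wave_fderiv, dotp_add, dotp_add]
    simp only [dotp_wave]
    have e0 : dotp l (fun i => (k i : ℝ)) = dotp k (fun i => (l i : ℝ)) := ip_comm l k
    simp only [wave, dotp_addk, Pi.add_apply, Pi.neg_apply, e0, ip]
    have e1 : dotp k q + dotp k q + 2 * θ = 2 * (dotp k q + θ) := by ring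
    have e2 : dotp l q + dotp l q + 2 * φ = 2 * (dotp l q + φ) := by ring
    rw [e1, e2, Real.sin_two_mul, Real.sin_two_mul]
    push_cast
    ring
  intro θ s
  have h := (key θ 0 (-s / ip k l) 1).add hV hr (key (θ + π / 2) (π / 2) (s / ip k l) 1)
  convert h using 2 with q
  funext i
  have e1 : dotp k q + (θ + π / 2) = dotp k q + θ + π / 2 := by ring
  have e2 : dotp k q + dotp l q + θ = (dotp k q + θ) + dotp l q := by ring
  have e3 : Real.sin (dotp k q + θ + dotp l q) = _ := Real.sin_add _ _
  simp only [wave, dotp_addk, Pi.add_apply, e1, e2, e3, Real.cos_add_pi_div_two,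
    Real.sin_add_pi_div_two, add_zero]
  push_cast
  field_simp
  ring

theorem ip_self_pos {k : Fin d → ℤ} (i : Fin d) (hi : k i ≠ 0) : 0 < ip k k := by
  simp only [ip, dotp]
  refine Finset.sum_pos' (fun j _ => mul_self_nonneg _) ⟨i, Finset.mem_univ _, ?_⟩
  have : (k i : ℝ) ≠ 0 := by exact_mod_cast hi
  exact mul_self_pos.2 this

theorem freq_basic (hV : VHyp V0) (hr : 1 ≤ r) (j : Fin d) : Freq V0 r (kvecZ d j) :=
  fun θ s => PK.wave_basic hV hr j θ s

theorem freq_single (hV : VHyp V0) (hr : 1 ≤ r) (j : Fin d) :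
    Freq V0 r (Pi.single j 1) := by
  have h1 : ∀ i : Fin d, (i : ℕ) < d - 1 → Freq V0 r (Pi.single i 1) := fun i hi => by
    have := freq_basic hV hr i
    rwa [kvecZ, if_pos hi] at this
  by_cases hj : (j : ℕ) < d - 1
  · exact h1 j hj
  have hjd : ∀ i : Fin d, i ≠ j → (i : ℕ) < d - 1 := by
    intro i hi
    have := i.2
    have := j.2
    have : (i : ℕ) ≠ j := fun h => hi (Fin.ext h)
    omega
  have h2 : ∀ S : Finset (Fin d), j ∉ S → Freq V0 r (fun i => if i ∈ S then 0 else 1) := by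
    intro S
    induction S using Finset.induction_on with
    | empty =>
      intro _
      have := freq_basic hV hr j
      rw [kvecZ, if_neg hj] at this
      simpa using this
    | insert a S ha ih =>
      intro hjS
      simp only [Finset.mem_insert, not_or] at hjS
      have haj := hjd a (Ne.symm hjS.1)
      have h := (ih hjS.2).add hV hr (h1 a haj).neg (ip_self_pos j (by simp [hjS.2]))
        (ip_self_pos a (by simp)) (by simp [ip, dotp, Pi.single_apply, ha])
      convert h using 1
      funext i
      by_cases hia : i = a
      · subst hia; simp [ha]
      · simp [hia]
  have h3 := h2 (Finset.univ.erase j) (by simp)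
  convert h3 using 1
  funext i
  by_cases hij : i = j
  · subst hij; simp
  · simp [hij]

theorem freq_mult (hV : VHyp V0) (hr : 1 ≤ r) (j : Fin d) (n : ℕ) :
    Freq V0 r (Pi.single j ((n : ℤ) + 1)) := by
  induction n with
  | zero => simpa using freq_single hV hr j
  | succ n ih =>
    have hn : ((n : ℤ) + 1) ≠ 0 := by omega
    have h := ih.add hV hr (freq_single hV hr j) (ip_self_pos j (by simpa using hn))
      (ip_self_pos j (by simp)) (by
        simp [ip, dotp, Pi.single_apply]
        positivity)
    convert h using 1
    rw [← Pi.single_add]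
    push_cast
    rfl

/-- Approximable coordinatewise kicks. -/
theorem PK.sin_coord (hV : VHyp V0) (hr : 1 ≤ r) (j : Fin d) (n : ℕ) (s : ℝ) :
    PK V0 r (fun q => Pi.single j (s * Real.sin (((n : ℝ) + 1) * q j))) := by
  have h := freq_mult hV hr j n 0 (s / ((n : ℝ) + 1))
  convert h using 2 with q
  funext i
  have e : dotp (Pi.single j ((n : ℤ) + 1)) q = ((n : ℝ) + 1) * q j := by
    simp only [dotp]
    rw [Finset.sum_eq_single j]
    · simp
    · intro i _ hi; simp [Pi.single_eq_of_ne hi]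
    · simp
  simp only [wave, e, add_zero]
  by_cases hij : i = j
  · subst hij
    simp only [Pi.single_eq_same]
    push_cast
    have : (n : ℝ) + 1 ≠ 0 := by positivity
    field_simp
  · simp [Pi.single_eq_of_ne hij]

end freq

section saw
variable {d : ℕ} {V0 : (Fin d → ℝ) → ℝ} {r : ℝ}

/-- The (regularized) sawtooth `2 arg(1 + ρ e^{ix})`. -/
noncomputable def sawR (ρ x : ℝ) : ℝ := 2 * Complex.arg (1 + ρ * Complex.exp (x * Complex.I))

theorem sawR_meas (ρ : ℝ) : Measurable (sawR ρ) := by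
  unfold sawR
  exact (Complex.measurable_arg.comp (by fun_prop)).const_mul 2

theorem sawR_per (ρ x : ℝ) (m : ℤ) : sawR ρ (x + m * (2 * π)) = sawR ρ x := by
  unfold sawR
  have : ((x + m * (2 * π) : ℝ) : ℂ) * Complex.I = x * Complex.I + m * (2 * π * Complex.I) := by
    push_cast; ring
  rw [this, Complex.exp_add, Complex.exp_int_mul_two_pi_mul_I, mul_one]

theorem sawR_hasSum {ρ : ℝ} (h0 : 0 ≤ ρ) (h1 : ρ < 1) (x : ℝ) :
    HasSum (fun n : ℕ => 2 * ((-1) ^ (n + 1) * ρ ^ n / n) * Real.sin (n * x)) (sawR ρ x) := by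
  have hz : ‖(ρ : ℂ) * Complex.exp (x * Complex.I)‖ < 1 := by
    rw [norm_mul, Complex.norm_exp_ofReal_mul_I, mul_one, Complex.norm_real,
      Real.norm_of_nonneg h0]
    exact h1
  have h := (Complex.hasSum_im (Complex.hasSum_taylorSeries_log hz)).mul_left 2
  rw [Complex.log_im] at h
  have hfun : (fun n : ℕ => 2 * ((-1) ^ (n + 1) * ρ ^ n / n) * Real.sin (n * x)) = fun i : ℕ => 2 *
      ((-1 : ℂ) ^ (i + 1) * ((ρ : ℂ) * Complex.exp (x * Complex.I)) ^ i / i).im := by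
    funext n
    have e : (-1 : ℂ) ^ (n + 1) * ((ρ : ℂ) * Complex.exp (x * Complex.I)) ^ n / n =
        (((-1) ^ (n + 1) * ρ ^ n / n : ℝ) : ℂ) * Complex.exp ((n * x : ℝ) * Complex.I) := by
      rw [mul_pow, ← Complex.exp_nat_mul]
      push_cast
      rw [mul_assoc (n : ℂ)]
      ring
    rw [e, Complex.im_ofReal_mul, Complex.exp_ofReal_mul_I_im]
    ring
  rw [hfun]
  exact h

/-- The sawtooth of period `2π/(m+1)`. -/
noncomputable def saw (m : ℕ) (y : ℝ) : ℝ := sawR 1 (((m : ℝ) + 1) * y) / ((m : ℝ) + 1)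

theorem sawR_eq {x : ℝ} (h1 : -π < x) (h2 : x < π) : sawR 1 x = x := by
  have hpi := Real.pi_pos
  have hc : 0 < Real.cos (x / 2) := Real.cos_pos_of_mem_Ioo ⟨by linarith, by linarith⟩
  have e : (1 : ℂ) + ((1 : ℝ) : ℂ) * Complex.exp (x * Complex.I) =
      ((2 * Real.cos (x / 2) : ℝ) : ℂ) *
        (Complex.cos ((x / 2 : ℝ) : ℂ) + Complex.sin ((x / 2 : ℝ) : ℂ) * Complex.I) := by
    have hx : (x : ℂ) = 2 * ((x / 2 : ℝ) : ℂ) := by push_cast; ring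
    rw [Complex.exp_mul_I, hx, Complex.cos_two_mul, Complex.sin_two_mul]
    push_cast
    ring
  unfold sawR
  rw [e, Complex.arg_mul_cos_add_sin_mul_I (by positivity) ⟨by linarith, by linarith⟩]
  ring

theorem saw_cell (m : ℕ) {y : ℝ} (hy : Real.cos (((m : ℝ) + 1) * y) ≠ -1) :
    ∃ c : ℝ, |y - c| < π / ((m : ℝ) + 1) ∧
      ∀ z, |z - c| < π / ((m : ℝ) + 1) → saw m z = z - c := by
  have hpi := Real.pi_pos
  have hN : (0 : ℝ) < (m : ℝ) + 1 := by positivity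
  set N : ℝ := (m : ℝ) + 1 with hNd
  set k : ℤ := round (N * y / (2 * π)) with hk
  have hr : |N * y - k * (2 * π)| ≤ π := by
    have h := abs_sub_round (N * y / (2 * π))
    have e : N * y - k * (2 * π) = (N * y / (2 * π) - k) * (2 * π) := by
      field_simp
    rw [e, abs_mul, abs_of_pos Real.two_pi_pos]
    nlinarith
  have hr' : |N * y - k * (2 * π)| < π := by
    refine lt_of_le_of_ne hr fun he => hy ?_
    have h2 : Real.cos (N * y - k * (2 * π)) = -1 := by
      rw [← Real.cos_abs, he, Real.cos_pi]
    rwa [Real.cos_sub_int_mul_two_pi] at h2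
  refine ⟨k * (2 * π) / N, ?_, fun z hz => ?_⟩
  · have e : y - k * (2 * π) / N = (N * y - k * (2 * π)) / N := by field_simp
    rw [e, abs_div, abs_of_pos hN]
    exact div_lt_div_of_pos_right hr' hN
  · have e : z - k * (2 * π) / N = (N * z - k * (2 * π)) / N := by field_simp
    rw [e] at hz ⊢
    rw [abs_div, abs_of_pos hN, div_lt_div_iff_of_pos_right hN, abs_lt] at hz
    unfold saw
    congr 1
    have e2 : N * z = (N * z - k * (2 * π)) + k * (2 * π) := by ring
    rw [← hNd]
    conv_lhs => rw [e2]
    rw [sawR_per]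
    exact sawR_eq hz.1 hz.2

theorem saw_bound (m : ℕ) (y : ℝ) : |saw m y| ≤ 2 * π * eps m := by
  have hN : (0 : ℝ) < (m : ℝ) + 1 := by positivity
  unfold saw sawR eps
  rw [abs_div, abs_of_pos hN, abs_mul, abs_two, mul_one_div]
  gcongr
  exact Complex.abs_arg_le_pi _

theorem saw_per (m : ℕ) (y : ℝ) (k : ℤ) : saw m (y + 2 * π * k) = saw m y := by
  unfold saw
  have e : ((m : ℝ) + 1) * (y + 2 * π * k) = ((m : ℝ) + 1) * y +
    (((m : ℤ) + 1) * k : ℤ) * (2 * π) := by push_cast; ring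
  rw [e, sawR_per]

/-- Vector sawtooth. -/
noncomputable def sawV (m : ℕ) (q : Fin d → ℝ) : Fin d → ℝ := fun i => saw m (q i)

theorem sawV_meas (m : ℕ) : Measurable (sawV (d := d) m) := by
  refine measurable_pi_lambda _ fun i => ?_
  exact ((sawR_meas 1).comp (by fun_prop)).div_const _

theorem sawV_per (m : ℕ) : PerQ (sawV (d := d) m) := by
  intro k q
  funext i
  exact saw_per m (q i) (k i)

theorem countable_bad (m : ℕ) : {y : ℝ | Real.cos (((m : ℝ) + 1) * y) = -1}.Countable := by
  refine (Set.countable_range fun k : ℤ => (π + k * (2 * π)) / ((m : ℝ) + 1)).mono ?_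
  intro y hy
  obtain ⟨k, hk⟩ := Real.cos_eq_neg_one_iff.1 hy
  refine ⟨k, ?_⟩
  have hN : (0 : ℝ) < (m : ℝ) + 1 := by positivity
  simp only [hk]
  field_simp

theorem single_tendsto {f : ℕ → ℝ} {a : ℝ} (j : Fin d) (h : Tendsto f atTop (𝓝 a)) :
    Tendsto (fun n => (Pi.single j (f n) : Fin d → ℝ)) atTop (𝓝 (Pi.single j a)) :=
  ((continuous_single (A := fun _ : Fin d => ℝ) j).tendsto a).comp h

theorem single_meas {f : ℝ → ℝ} (j : Fin d) (h : Measurable f) :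
    Measurable (fun q : Fin d → ℝ => (Pi.single j (f (q j)) : Fin d → ℝ)) :=
  (continuous_single (A := fun _ : Fin d => ℝ) j).measurable.comp (h.comp (measurable_pi_apply j))

theorem sawR_per' (ρ : ℝ) (m : ℕ) (y : ℝ) (k : ℤ) :
    sawR ρ (((m : ℝ) + 1) * (y + 2 * π * k)) = sawR ρ (((m : ℝ) + 1) * y) := by
  have e : ((m : ℝ) + 1) * (y + 2 * π * k) = ((m : ℝ) + 1) * y +
    (((m : ℤ) + 1) * k : ℤ) * (2 * π) := by push_cast; ring
  rw [e, sawR_per]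

theorem PK.sawR_coord (hV : VHyp V0) (hr : 1 ≤ r) (j : Fin d) (m : ℕ) (c : ℝ) {ρ : ℝ}
    (h0 : 0 ≤ ρ) (h1 : ρ < 1) :
    PK V0 r (fun q => Pi.single j (c * sawR ρ (((m : ℝ) + 1) * q j))) := by
  refine PK.of_tendsto hV hr (G := fun M q => ∑ n ∈ Finset.range M,
    Pi.single j (c * (2 * ((-1) ^ (n + 1) * ρ ^ n / n) * Real.sin (n * (((m : ℝ) + 1) * q j)))))
    ?_ ?_ (fun M => PK.sum hV hr _ fun n _ => ?_) (Eventually.of_forall fun x => ?_)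
  · exact single_meas j (f := fun y => c * sawR ρ (((m : ℝ) + 1) * y))
      (((sawR_meas ρ).comp (by fun_prop)).const_mul c)
  · intro k q
    have := sawR_per' ρ m (q j) (k j)
    simp only [latt, Pi.add_apply, this]
  · rcases n with _ | n
    · have := PK.zero (V0 := V0) (r := r)
      simpa using this
    · have := PK.sin_coord hV hr j (n * m + n + m) (c * (2 * ((-1) ^ (n + 1 + 1) * ρ ^ (n + 1) /
        (n + 1 : ℕ))))
      convert this using 3 with q
      have e : ((n + 1 : ℕ) : ℝ) * (((m : ℝ) + 1) * q j) =
          (((n * m + n + m : ℕ) : ℝ) + 1) * q j := by push_cast; ring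
      rw [e]
      ring
  · have h := (sawR_hasSum h0 h1 (((m : ℝ) + 1) * x.1 j)).tendsto_sum_nat
    have h2 := single_tendsto j (h.const_mul c)
    refine h2.congr fun M => ?_
    rw [Finset.mul_sum]
    exact map_sum (AddMonoidHom.single (fun _ : Fin d => ℝ) j) _ _

theorem PK.saw_coord (hV : VHyp V0) (hr : 1 ≤ r) (j : Fin d) (m : ℕ) (c : ℝ) :
    PK V0 r (fun q => Pi.single j (c * saw m (q j))) := by
  refine PK.of_tendsto hV hr (G := fun n q => Pi.single j (c / ((m : ℝ) + 1) *
      sawR (1 - eps n) (((m : ℝ) + 1) * q j)))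
    ?_ ?_ (fun n => PK.sawR_coord hV hr j m _ ?_ ?_) ?_
  · exact single_meas j (f := fun y => c * saw m y)
      ((((sawR_meas 1).comp (by fun_prop)).div_const _).const_mul c)
  · intro k q
    have := saw_per m (q j) (k j)
    simp only [latt, Pi.add_apply, this]
  · have : eps n ≤ 1 := by
      unfold eps
      rw [div_le_one (by positivity)]
      have : (0 : ℝ) ≤ n := by positivity
      linarith
    linarith
  · have := eps_pos n
    linarith
  · filter_upwards [ae_coord (d := d) (countable_bad m)] with x hx
    have hj : Real.cos (((m : ℝ) + 1) * x.1 j) ≠ -1 := hx j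
    set w : ℝ := ((m : ℝ) + 1) * x.1 j with hw
    have hs : (1 : ℂ) + ((1 : ℝ) : ℂ) * Complex.exp (w * Complex.I) ∈ Complex.slitPlane := by
      rw [Complex.mem_slitPlane_iff]
      left
      rw [Complex.ofReal_one, one_mul, Complex.add_re, Complex.one_re, Complex.exp_ofReal_mul_I_re]
      have := Real.neg_one_le_cos w
      have := lt_of_le_of_ne this (Ne.symm hj)
      linarith
    have hc : ContinuousAt (fun ρ : ℝ => sawR ρ w) 1 := by
      unfold sawR
      refine ContinuousAt.mul continuousAt_const ?_
      exact ContinuousAt.comp (g := Complex.arg)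
        (f := fun ρ : ℝ => (1 : ℂ) + ρ * Complex.exp (w * Complex.I))
        (Complex.continuousAt_arg hs) (by fun_prop)
    have hl : Tendsto (fun n => 1 - eps n) atTop (𝓝 1) := by
      simpa using eps_lim.const_sub 1
    have h2 := (hc.tendsto.comp hl).const_mul (c / ((m : ℝ) + 1))
    have h3 := single_tendsto j h2
    have e : c * saw m (x.1 j) = c / ((m : ℝ) + 1) * sawR 1 w := by
      unfold saw; rw [hw]; ring
    rw [e]
    exact h3

theorem PK.sawV (hV : VHyp V0) (hr : 1 ≤ r) (m : ℕ) (c : ℝ) :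
    PK V0 r (fun q => c • sawV m q) := by
  have := PK.sum hV hr Finset.univ fun j _ => PK.saw_coord hV hr j m c
  convert this using 2 with q
  funext i
  rw [Finset.sum_apply, Finset.sum_eq_single i]
  · simp [_root_.sawV]
  · intro j _ hj; simp [Pi.single_eq_of_ne (Ne.symm hj)]
  · simp

end saw

section refl
variable {d : ℕ} {V0 : (Fin d → ℝ) → ℝ} {r : ℝ}

theorem drift_err {F : (Fin d → ℝ) → (Fin d → ℝ)} {C : ℝ} (hC : ∀ q, ‖F q‖ ≤ C)
    {φ : ℝ → Phase d → Phase d} (h0 : ∀ y, φ 0 y = y)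
    (hφ : ∀ y t, HasDerivAt (fun s => φ s y) (mechX F (φ t y)) t) (y : ℕ → Phase d) :
    ∃ a b : ℕ → (Fin d → ℝ), Tendsto a atTop (𝓝 0) ∧ Tendsto b atTop (𝓝 0) ∧
      (∀ n, (φ (eps n) (y n)).2 = (y n).2 + a n) ∧
      ∀ n, (φ (eps n) (y n)).1 = (y n).1 + eps n • ((y n).2 + b n) := by
  refine ⟨fun n => (φ (eps n) (y n)).2 - (y n).2,
    fun n => (eps n)⁻¹ • ((φ (eps n) (y n)).1 - (y n).1 - eps n • (y n).2), ?_, ?_,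
    fun n => (add_sub_cancel _ _).symm, fun n => ?_⟩
  · refine squeeze_zero_norm (a := fun n => C * eps n) (fun n => ?_) ?_
    · have := curve_est_a hC (hφ (y n)) (eps_pos n).le
      simpa only [h0] using this
    · simpa using eps_lim.const_mul C
  · refine squeeze_zero_norm (a := fun n => C * eps n) (fun n => ?_) ?_
    · have := curve_est_b hC (hφ (y n)) (eps_pos n).le
      simp only [h0] at this
      rw [norm_smul, Real.norm_of_nonneg (inv_pos.2 (eps_pos n)).le, inv_mul_le_iff₀ (eps_pos n)]
      refine this.trans (le_of_eq ?_)
      ring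
    · simpa using eps_lim.const_mul C
  · rw [smul_add, smul_smul, mul_inv_cancel₀ (eps_pos n).ne', one_smul]
    abel

/-- Cellwise reflection. -/
noncomputable def reflN (m : ℕ) (x : Phase d) : Phase d :=
  (x.1 - (2 : ℝ) • sawV m x.1, -x.2)

theorem cell_ae (m : ℕ) : ∀ᵐ x : Phase d, ∃ c : Fin d → ℝ,
    (∀ i, |x.1 i - c i| < π / ((m : ℝ) + 1)) ∧
      ∀ z : Fin d → ℝ, (∀ i, |z i - c i| < π / ((m : ℝ) + 1)) → sawV m z = z - c := by
  filter_upwards [ae_coord (d := d) (countable_bad m)] with x hx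
  choose c hc hc2 using fun i => saw_cell m (y := x.1 i) (hx i)
  exact ⟨c, hc, fun z hz => funext fun i => hc2 i (z i) (hz i)⟩

theorem cell_eventually {B : ℝ} {c l : Fin d → ℝ} {z : ℕ → Fin d → ℝ}
    (hz : Tendsto z atTop (𝓝 l)) (hl : ∀ i, |l i - c i| < B) :
    ∀ᶠ n in atTop, ∀ i, |z n i - c i| < B := by
  rw [eventually_all]
  intro i
  have h1 : Tendsto (fun n => |z n i - c i|) atTop (𝓝 |l i - c i|) :=
    ((tendsto_pi_nhds.1 hz i).sub_const _).abs
  exact h1.eventually (gt_mem_nhds (hl i))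

theorem reflN_meas (m : ℕ) : Measurable (reflN (d := d) m) := by
  unfold reflN
  exact (measurable_fst.sub (((sawV_meas m).comp measurable_fst).const_smul (2 : ℝ))).prodMk
    measurable_snd.neg

theorem reflN_equi (m : ℕ) (k : Fin d → ℤ) (x : Phase d) :
    reflN m (x + latt k) = reflN m x + latt k := by
  have h := sawV_per m k x.1
  ext i
  · simp only [reflN, Prod.fst_add, h, Pi.add_apply, Pi.sub_apply]
    ring
  · simp [reflN, latt]

theorem reflN_invol (m : ℕ) : ∀ᵐ x : Phase d, reflN m (reflN m x) = x := by
  filter_upwards [cell_ae (d := d) m] with x hx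
  obtain ⟨c, hc, hc2⟩ := hx
  have h1 := hc2 x.1 hc
  have h2 := hc2 (x.1 - (2 : ℝ) • (x.1 - c)) (fun i => by
    have : (x.1 - (2 : ℝ) • (x.1 - c)) i - c i = -(x.1 i - c i) := by
      simp only [Pi.sub_apply, Pi.smul_apply, smul_eq_mul]; ring
    rw [this, abs_neg]
    exact hc i)
  unfold reflN
  simp only [h1, h2]
  ext i
  · simp only [Pi.sub_apply, Pi.smul_apply, smul_eq_mul]; ring
  · simp

theorem reflN_appr (hV : VHyp V0) (hr : 1 ≤ r) (m : ℕ) :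
    MeasurePreserving (reflN (d := d) m) ∧ ApprS V0 r (reflN m) := by
  obtain ⟨K0, C0, hK0, hC0⟩ := per_lip (force0_smooth hV) (force0_per hV)
  obtain ⟨φ, hφ⟩ := force_exists_flow hV (0 : Fin d → ℝ × ℝ)
  have hfl : ∀ y t, HasDerivAt (fun s => φ s y) (mechX (force0 V0) (φ t y)) t := by
    intro y t
    have := hφ.2 y t
    rw [hamVF_eq hV] at this
    have h0 : ∀ q, forceU (0 : Fin d → ℝ × ℝ) q = 0 := fun q => by
      simpa using forceU_smul 0 (0 : Fin d → ℝ × ℝ) q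
    simpa only [h0, add_zero] using this
  set F : ℕ → Phase d → Phase d := fun n => kick (fun q => (-(eps n)⁻¹) • sawV m q) ∘
    (φ (eps n) ∘ (kick (fun q => (-(2 * (eps n)⁻¹)) • sawV m q) ∘
      (φ (eps n) ∘ kick (fun q => (-(eps n)⁻¹) • sawV m q)))) with hF
  have happ : ∀ δ > 0, ∀ n, eps n ≤ δ / 5 → Appr V0 r δ (F n) := by
    intro δ hδ n hn
    have h5 : 0 < δ / 5 := by linarith
    have hs := fun c => (PK.sawV (V0 := V0) hV hr m c).appr (δ / 5) h5
    have hd : Appr V0 r (δ / 5) (φ (eps n)) := Appr.flow hV hφ (eps_pos n).le hn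
    have := (hs (-(eps n)⁻¹)).comp hV hr (hd.comp hV hr ((hs (-(2 * (eps n)⁻¹))).comp hV hr
      (hd.comp hV hr (hs (-(eps n)⁻¹)))))
    have e : δ / 5 + (δ / 5 + (δ / 5 + (δ / 5 + δ / 5))) = δ := by ring
    rw [e] at this
    exact this
  have hgood : ∀ n, Good (F n) := fun n =>
    (happ (5 * eps n) (by have := eps_pos n; linarith) n (by linarith)).1
  have hlim : ∀ᵐ x : Phase d, Tendsto (fun n => F n x) atTop (𝓝 (reflN m x)) := by
    filter_upwards [cell_ae (d := d) m] with x hx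
    obtain ⟨c, hc, hc2⟩ := hx
    have hne : ∀ n, eps n ≠ 0 := fun n => (eps_pos n).ne'
    have hx1 := hc2 x.1 hc
    set y1 : ℕ → Phase d := fun n => (x.1, x.2 + (-(eps n)⁻¹) • sawV m x.1) with hy1
    obtain ⟨a1, b1, ha1, hb1, hz1p, hz1q⟩ := drift_err hC0 hφ.1 hfl y1
    set z1 : ℕ → Phase d := fun n => φ (eps n) (y1 n) with hz1
    set y2 : ℕ → Phase d := fun n =>
      ((z1 n).1, (z1 n).2 + (-(2 * (eps n)⁻¹)) • sawV m (z1 n).1) with hy2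
    obtain ⟨a2, b2, ha2, hb2, hz2p, hz2q⟩ := drift_err hC0 hφ.1 hfl y2
    set z2 : ℕ → Phase d := fun n => φ (eps n) (y2 n) with hz2
    have hFn : ∀ n, F n x = ((z2 n).1, (z2 n).2 + (-(eps n)⁻¹) • sawV m (z2 n).1) := fun n => rfl
    have q1 : ∀ n, (z1 n).1 = c + eps n • (x.2 + b1 n) := by
      intro n
      have := hz1q n
      refine this.trans ?_
      simp only [hy1, hx1]
      have := hne n
      ext i
      simp only [Pi.sub_apply, Pi.smul_apply, Pi.add_apply, smul_eq_mul]
      field_simp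
      ring
    have l1 : Tendsto (fun n => (z1 n).1) atTop (𝓝 c) := by
      have := (eps_lim.smul (hb1.const_add x.2)).const_add c
      rw [zero_smul, add_zero] at this
      exact this.congr fun n => (q1 n).symm
    have hpos : 0 < π / ((m : ℝ) + 1) := by have := Real.pi_pos; positivity
    have ev1 : ∀ᶠ n in atTop, sawV m (z1 n).1 = (z1 n).1 - c :=
      (cell_eventually l1 (c := c) (fun i => by simpa using hpos)).mono fun n hn => hc2 _ hn
    have p2 : ∀ᶠ n in atTop, (y2 n).2 =
        -x.2 - (eps n)⁻¹ • (x.1 - c) + a1 n - (2 : ℝ) • b1 n := by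
      filter_upwards [ev1] with n hn
      have h1 : (z1 n).2 = (y1 n).2 + a1 n := hz1p n
      have h2 : (y2 n).2 = (z1 n).2 + (-(2 * (eps n)⁻¹)) • sawV m (z1 n).1 := rfl
      rw [h2, hn, h1, q1 n]
      simp only [hy1, hx1]
      have := hne n
      ext i
      simp only [Pi.sub_apply, Pi.smul_apply, Pi.add_apply, Pi.neg_apply, smul_eq_mul]
      field_simp
      ring
    have q2 : ∀ᶠ n in atTop, c - (x.1 - c) + eps n • (a1 n - b1 n + b2 n) = (z2 n).1 := by
      filter_upwards [p2] with n hn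
      have h1 : (z2 n).1 = (y2 n).1 + eps n • ((y2 n).2 + b2 n) := hz2q n
      have h2 : (y2 n).1 = (z1 n).1 := rfl
      rw [h1, hn, h2, q1 n]
      have := hne n
      ext i
      simp only [Pi.sub_apply, Pi.smul_apply, Pi.add_apply, Pi.neg_apply, smul_eq_mul]
      field_simp
      ring
    have l2 : Tendsto (fun n => (z2 n).1) atTop (𝓝 (c - (x.1 - c))) := by
      have := (eps_lim.smul ((ha1.sub hb1).add hb2)).const_add (c - (x.1 - c))
      rw [zero_smul, add_zero] at this
      exact this.congr' q2
    have ev2 : ∀ᶠ n in atTop, sawV m (z2 n).1 = (z2 n).1 - c :=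
      (cell_eventually l2 (c := c) (fun i => by
        have : (c - (x.1 - c)) i - c i = -(x.1 i - c i) := by
          simp only [Pi.sub_apply]; ring
        rw [this, abs_neg]
        exact hc i)).mono fun n hn => hc2 _ hn
    have p3 : ∀ᶠ n in atTop, -x.2 - b1 n + a2 n - b2 n =
        (z2 n).2 + (-(eps n)⁻¹) • sawV m (z2 n).1 := by
      filter_upwards [ev2, q2, p2] with n h1 h2 h3
      have h4 : (z2 n).2 = (y2 n).2 + a2 n := hz2p n
      rw [h1, ← h2, h4, h3]
      have := hne n
      ext i
      simp only [Pi.sub_apply, Pi.smul_apply, Pi.add_apply, Pi.neg_apply, smul_eq_mul]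
      field_simp
      ring
    have l3 : Tendsto (fun n => (z2 n).2 + (-(eps n)⁻¹) • sawV m (z2 n).1) atTop (𝓝 (-x.2)) := by
      have := ((hb1.const_sub (-x.2)).add ha2).sub hb2
      simp only [sub_zero, add_zero] at this
      exact this.congr' p3
    have e : reflN m x = (c - (x.1 - c), -x.2) := by
      unfold reflN
      rw [hx1]
      congr 1
      rw [two_smul]
      abel
    simp only [hFn, e]
    exact l2.prodMk_nhds l3
  have hcontr := contr_of_tendsto_ae hgood (reflN_meas m) hlim
  have hgoodR : Good (reflN (d := d) m) := ⟨reflN_meas m, reflN_equi m, hcontr⟩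
  have hmp : MeasurePreserving (reflN (d := d) m) := by
    refine ⟨reflN_meas m, le_antisymm hcontr ?_⟩
    have h1 : (volume : Measure (Phase d)).map (reflN m ∘ reflN m) = volume := by
      have h2 : (reflN (d := d) m ∘ reflN m) =ᵐ[volume] id := reflN_invol m
      rw [Measure.map_congr h2, Measure.map_id]
    rw [← Measure.map_map (reflN_meas m) (reflN_meas m)] at h1
    calc (volume : Measure (Phase d))
        = ((volume : Measure (Phase d)).map (reflN m)).map (reflN m) := h1.symm
      _ ≤ (volume : Measure (Phase d)).map (reflN m) := Measure.map_mono hcontr (reflN_meas m)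
  refine ⟨hmp, ApprS.of_tendsto hV hr hgoodR hmp (F := F) (fun δ hδ => ?_) hlim⟩
  filter_upwards [eps_lim.eventually (gt_mem_nhds (show 0 < δ / 5 by linarith))] with n hn
  exact happ δ hδ n hn.le

theorem sym_appr (hV : VHyp V0) (hr : 1 ≤ r) :
    ApprS V0 r (fun x : Phase d => (x.1, -x.2)) := by
  have hmp : MeasurePreserving (fun x : Phase d => ((x.1, -x.2) : Phase d)) :=
    (MeasurePreserving.id volume).prod (Measure.measurePreserving_neg volume)
  refine ApprS.of_tendsto hV hr (F := fun m => reflN m) (Good.of_mp hmp fun k x => ?_) hmp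
    (fun δ hδ => Eventually.of_forall fun m => (reflN_appr hV hr m).2 δ hδ)
    (Eventually.of_forall fun x => ?_)
  · ext i <;> simp [latt]
  · have h0 : Tendsto (fun m => sawV m x.1) atTop (𝓝 0) := by
      rw [tendsto_pi_nhds]
      intro i
      refine squeeze_zero_norm (fun m => saw_bound m (x.1 i)) ?_
      simpa using eps_lim.const_mul (2 * π)
    have h1 := (h0.const_smul (2 : ℝ)).const_sub x.1
    rw [smul_zero, sub_zero] at h1
    exact h1.prodMk_nhds tendsto_const_nhds

end refl

end helpers

/-- **Lemma (the non-Hamiltonian symmetry `S(q,p) = (q,−p)` is reachable on densities).**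
For the torus control system (lifted to `ℝ^d × ℝ^d`)
`H_u(q,p) = |p|²/2 + V_0(q) + Σ_{j=1}^d (u_{2j−1} cos(k_j·q) + u_{2j} sin(k_j·q))` with
`V_0` smooth and `2π`-periodic: for every `r ∈ [1,∞)`, every torus density `ρ` and every
`ε > 0`, there are `τ ∈ [0,ε]` and a piecewise constant control realizing a flow map
`Φ^τ_{H_u}` with `‖ρ ∘ Φ^τ_{H_u} − ρ ∘ S‖_{L^r(Q)} < ε`, where `Q = [0,2π)^d × ℝ^d`. -/
theorem torus_symmetry_reachable_on_densities
    (d : ℕ) (V0 : (Fin d → ℝ) → ℝ) (hV0 : ContDiff ℝ (⊤ : ℕ∞) V0)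
    (hper : ∀ (q : Fin d → ℝ) (k : Fin d → ℤ),
      V0 (fun i => q i + 2 * Real.pi * (k i)) = V0 q)
    (r : ℝ) (hr : 1 ≤ r) (ρ : Phase d → ℝ)
    (hρ : IsTorusDensity (ENNReal.ofReal r) ρ) :
    ∀ ε > (0:ℝ), ∃ τ ∈ Set.Icc (0:ℝ) ε, ∃ Φ : Phase d → Phase d,
      Reachable (torusHam V0) τ Φ ∧
      eLpNorm (fun x => ρ (Φ x) - ρ (x.1, -x.2)) (ENNReal.ofReal r)
          (volume.restrict (torusBlock d))
        < ENNReal.ofReal ε := by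
  intro ε hε
  have hV : VHyp V0 := ⟨hV0, hper⟩
  exact (sym_appr hV hr ε hε).2 ρ hρ ε hε
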